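/- Let W be a wedge of finitely many spheres of dimensions 1, 2, and 3. Then the half-smash W \rtimes \Omega S^2 is homotopy equivalent to a wedge of spheres. -/

import Mathlib

noncomputable section

/-- The based loop space of a pointed space. -/
abbrev LoopSp (X : Type*) [TopologicalSpace X] (x : X) : Type _ :=
  {γ : C(unitInterval, X) // γ 0 = x ∧ γ 1 = x}

/-- The right half-smash `X ⋊ Y = (X × Y)/({x₀} × Y)`. -/
abbrev HalfSmash (X Y : Type*) [TopologicalSpace X] [TopologicalSpace Y] (x₀ : X) : Type _ :=
  Quot (fun u v : X × Y => u.1 = x₀ ∧ v.1 = x₀)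

/-- The wedge (one-point union) of a family of pointed spaces. -/
abbrev WedgeFam (ι : Type*) (X : ι → Type*) [∀ i, TopologicalSpace (X i)]
    (pt : ∀ i, X i) : Type _ :=
  Quot (fun u v : Σ i, X i => u.2 = pt u.1 ∧ v.2 = pt v.1)

/-- The `d`-dimensional unit sphere `S^d ⊆ ℝ^{d+1}`. -/
abbrev SphereSp (d : ℕ) : Type :=
  Metric.sphere (0 : EuclideanSpace ℝ (Fin (d + 1))) 1

/-- A basepoint on `S^d`. -/
def spherePt (d : ℕ) : SphereSp d :=
  ⟨EuclideanSpace.single 0 1, by simp [EuclideanSpace.norm_single]⟩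

open unitInterval Topology Filter

/-- Homotopies of maps that are constant on the base point. -/
def PHtpy {X Y : Type*} [TopologicalSpace X] [TopologicalSpace Y] (x₀ : X) (f g : X → Y) : Prop :=
  ∃ H : I × X → Y, Continuous H ∧ (∀ x, H (0, x) = f x) ∧ (∀ x, H (1, x) = g x) ∧
    ∀ s, H (s, x₀) = f x₀

namespace PHtpy

variable {X Y Z : Type*} [TopologicalSpace X] [TopologicalSpace Y] [TopologicalSpace Z]
  {x₀ : X} {f g h : X → Y}

theorem continuous_left (H : PHtpy x₀ f g) : Continuous f := by
  obtain ⟨H, hc, h0, -⟩ := H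
  rw [← funext h0]
  fun_prop

theorem base (H : PHtpy x₀ f g) : g x₀ = f x₀ := by
  obtain ⟨H, -, -, h1, hb⟩ := H
  rw [← h1, hb]

theorem refl (hf : Continuous f) : PHtpy x₀ f f :=
  ⟨fun p => f p.2, by fun_prop, fun _ => rfl, fun _ => rfl, fun _ => rfl⟩

theorem symm (H : PHtpy x₀ f g) : PHtpy x₀ g f := by
  have hb := H.base
  obtain ⟨H, hc, h0, h1, h2⟩ := H
  refine ⟨fun p => H (σ p.1, p.2), by fun_prop, by simp [h1], by simp [h0], fun s => ?_⟩
  simp [h2, hb]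

theorem continuous_right (H : PHtpy x₀ f g) : Continuous g := H.symm.continuous_left

theorem trans (H : PHtpy x₀ f g) (K : PHtpy x₀ g h) : PHtpy x₀ f h := by
  have hf := H.continuous_left
  have hg := K.continuous_left
  have hh := K.continuous_right
  have hb := H.base
  obtain ⟨H, hc, h0, h1, h2⟩ := H
  obtain ⟨K, kc, k0, k1, k2⟩ := K
  let F : ContinuousMap.Homotopy (⟨f, hf⟩ : C(X, Y)) ⟨g, hg⟩ := ⟨⟨H, hc⟩, h0, h1⟩
  let G : ContinuousMap.Homotopy (⟨g, hg⟩ : C(X, Y)) ⟨h, hh⟩ := ⟨⟨K, kc⟩, k0, k1⟩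
  refine ⟨F.trans G, (F.trans G).continuous, (F.trans G).apply_zero, (F.trans G).apply_one,
    fun s => ?_⟩
  rw [ContinuousMap.Homotopy.trans_apply]
  split_ifs
  · exact h2 _
  · exact (k2 _).trans hb

theorem postcomp (H : PHtpy x₀ f g) {k : Y → Z} (hk : Continuous k) :
    PHtpy x₀ (k ∘ f) (k ∘ g) := by
  obtain ⟨H, hc, h0, h1, h2⟩ := H
  exact ⟨k ∘ H, hk.comp hc, fun x => congrArg k (h0 x), fun x => congrArg k (h1 x),
    fun s => congrArg k (h2 s)⟩

theorem precomp (H : PHtpy x₀ f g) {k : Z → X} (hk : Continuous k) {z₀ : Z} (hz : k z₀ = x₀) :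
    PHtpy z₀ (f ∘ k) (g ∘ k) := by
  obtain ⟨H, hc, h0, h1, h2⟩ := H
  exact ⟨fun p => H (p.1, k p.2), by fun_prop, fun x => h0 _, fun x => h1 _,
    fun s => by simp [hz, h2]⟩

end PHtpy

/-- Pointed homotopy equivalence of pointed spaces. -/
def PHE {X Y : Type*} [TopologicalSpace X] [TopologicalSpace Y] (x₀ : X) (y₀ : Y) : Prop :=
  ∃ (f : X → Y) (g : Y → X), Continuous f ∧ Continuous g ∧ f x₀ = y₀ ∧ g y₀ = x₀ ∧
    PHtpy x₀ (g ∘ f) id ∧ PHtpy y₀ (f ∘ g) id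

namespace PHE

variable {X Y Z : Type*} [TopologicalSpace X] [TopologicalSpace Y] [TopologicalSpace Z]
  {x₀ : X} {y₀ : Y} {z₀ : Z}

theorem of_homeomorph (e : X ≃ₜ Y) (h : e x₀ = y₀) : PHE x₀ y₀ := by
  refine ⟨e, e.symm, e.continuous, e.symm.continuous, h, by simp [← h], ?_, ?_⟩
  · rw [show e.symm ∘ e = id from by ext; simp]; exact .refl continuous_id
  · rw [show e ∘ e.symm = id from by ext; simp]; exact .refl continuous_id

theorem trans (H : PHE x₀ y₀) (K : PHE y₀ z₀) : PHE x₀ z₀ := by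
  obtain ⟨f, g, hf, hg, hfx, hgy, h1, h2⟩ := H
  obtain ⟨f', g', hf', hg', hfx', hgy', h1', h2'⟩ := K
  refine ⟨f' ∘ f, g ∘ g', hf'.comp hf, hg.comp hg', by simp [*], by simp [*], ?_, ?_⟩
  · exact ((h1'.postcomp hg).precomp hf hfx).trans h1
  · exact ((h2.postcomp hf').precomp hg' hgy').trans h2'

theorem homotopyEquiv (H : PHE x₀ y₀) : Nonempty (ContinuousMap.HomotopyEquiv X Y) := by
  obtain ⟨f, g, hf, hg, -, -, ⟨F, F1, F2, F3, -⟩, G, G1, G2, G3, -⟩ := H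
  exact ⟨⟨⟨f, hf⟩, ⟨g, hg⟩, ⟨⟨⟨F, F1⟩, F2, F3⟩⟩, ⟨⟨⟨G, G1⟩, G2, G3⟩⟩⟩⟩

end PHE

section Wedge

variable {ι : Type*} {X : ι → Type*} [∀ i, TopologicalSpace (X i)] {pt : ∀ i, X i}

omit [∀ i, TopologicalSpace (X i)] in
theorem wedge_base (i j : ι) :
    (Quot.mk _ ⟨i, pt i⟩ : WedgeFam ι X pt) = Quot.mk _ ⟨j, pt j⟩ :=
  Quot.sound ⟨rfl, rfl⟩

theorem continuous_wedge_mk (i : ι) :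
    Continuous (fun x : X i => (Quot.mk _ ⟨i, x⟩ : WedgeFam ι X pt)) :=
  continuous_quot_mk.comp continuous_sigmaMk

theorem continuous_wedge_prod {T Y : Type*} [TopologicalSpace T] [TopologicalSpace Y]
    [LocallyCompactSpace T] {F : T × WedgeFam ι X pt → Y}
    (h : ∀ i, Continuous fun p : T × X i => F (p.1, Quot.mk _ ⟨i, p.2⟩)) : Continuous F := by
  refine isQuotientMap_quot_mk.continuous_lift_prod_right ?_
  have : Continuous fun p : (Σ i, X i) × T => F (p.2, Quot.mk _ p.1) := by
    rw [← (Homeomorph.sigmaProdDistrib (X := X) (Y := T)).symm.comp_continuous_iff',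
      continuous_sigma_iff]
    intro i
    exact (h i).comp continuous_swap
  exact this.comp continuous_swap

/-- The map out of a wedge given by maps that agree on the base points. -/
def wedgeDesc {Y : Type*} (y₀ : Y) (F : ∀ i, X i → Y) (h : ∀ i, F i (pt i) = y₀) :
    WedgeFam ι X pt → Y :=
  Quot.lift (fun u => F u.1 u.2) (by
    rintro ⟨i, x⟩ ⟨j, y⟩ ⟨hx, hy⟩
    dsimp only at hx hy ⊢
    rw [hx, hy, h, h])

theorem continuous_wedgeDesc {Y : Type*} [TopologicalSpace Y] (y₀ : Y) (F : ∀ i, X i → Y)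
    (h : ∀ i, F i (pt i) = y₀) (hF : ∀ i, Continuous (F i)) :
    Continuous (wedgeDesc y₀ F h) :=
  continuous_quot_lift _ (continuous_sigma hF)

/-- Pointed homotopies on the summands of a wedge assemble to one on the wedge. -/
theorem PHtpy.wedge {Y : Type*} [TopologicalSpace Y] (i₀ : ι) {f g : WedgeFam ι X pt → Y}
    (h : ∀ i, PHtpy (pt i) (fun x => f (Quot.mk _ ⟨i, x⟩)) (fun x => g (Quot.mk _ ⟨i, x⟩))) :
    PHtpy (Quot.mk _ ⟨i₀, pt i₀⟩) f g := by
  choose H hc h0 h1 h2 using h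
  refine ⟨fun p => wedgeDesc (pt := pt) (f (Quot.mk _ ⟨i₀, pt i₀⟩)) (fun i x => H i (p.1, x))
    (fun i => (h2 i _).trans (congrArg f (wedge_base i i₀))) p.2, ?_, ?_, ?_, fun s => ?_⟩
  · exact continuous_wedge_prod fun i => hc i
  · rintro ⟨i, x⟩
    exact h0 i x
  · rintro ⟨i, x⟩
    exact h1 i x
  · exact h2 _ _

theorem PHE.wedge {Y : ι → Type*} [∀ i, TopologicalSpace (Y i)] {pt' : ∀ i, Y i} (i₀ : ι)
    (h : ∀ i, PHE (pt i) (pt' i)) :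
    PHE (Quot.mk _ ⟨i₀, pt i₀⟩ : WedgeFam ι X pt) (Quot.mk _ ⟨i₀, pt' i₀⟩ : WedgeFam ι Y pt') := by
  choose f g hf hg hfx hgy h1 h2 using h
  have e1 : ∀ i, (Quot.mk _ ⟨i, f i (pt i)⟩ : WedgeFam ι Y pt') = Quot.mk _ ⟨i₀, pt' i₀⟩ :=
    fun i => by rw [hfx, wedge_base]
  have e2 : ∀ i, (Quot.mk _ ⟨i, g i (pt' i)⟩ : WedgeFam ι X pt) = Quot.mk _ ⟨i₀, pt i₀⟩ :=
    fun i => by rw [hgy, wedge_base]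
  refine ⟨wedgeDesc _ (fun i x => Quot.mk _ ⟨i, f i x⟩) e1,
    wedgeDesc _ (fun i x => Quot.mk _ ⟨i, g i x⟩) e2,
    continuous_wedgeDesc _ _ _ fun i => (continuous_wedge_mk i).comp (hf i),
    continuous_wedgeDesc _ _ _ fun i => (continuous_wedge_mk i).comp (hg i),
    e1 i₀, e2 i₀, ?_, ?_⟩
  · exact PHtpy.wedge i₀ fun i => (h1 i).postcomp (continuous_wedge_mk i)
  · exact PHtpy.wedge i₀ fun i => (h2 i).postcomp (continuous_wedge_mk i)

/-- A wedge of wedges is the wedge over the pairs of indices. -/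
theorem PHE.wedge_wedge {κ : Type*} {X : ι → κ → Type*} [∀ i k, TopologicalSpace (X i k)]
    {pt : ∀ i k, X i k} (i₀ : ι) (k₀ : κ) :
    PHE (Quot.mk _ ⟨i₀, Quot.mk _ ⟨k₀, pt i₀ k₀⟩⟩ :
        WedgeFam ι (fun i => WedgeFam κ (X i) (pt i)) (fun i => Quot.mk _ ⟨k₀, pt i k₀⟩))
      (Quot.mk _ ⟨(i₀, k₀), pt i₀ k₀⟩ :
        WedgeFam (ι × κ) (fun p => X p.1 p.2) (fun p => pt p.1 p.2)) := by
  let f : WedgeFam ι (fun i => WedgeFam κ (X i) (pt i)) (fun i => Quot.mk _ ⟨k₀, pt i k₀⟩) →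
      WedgeFam (ι × κ) (fun p => X p.1 p.2) (fun p => pt p.1 p.2) :=
    wedgeDesc (Quot.mk _ ⟨(i₀, k₀), pt i₀ k₀⟩)
      (fun i => wedgeDesc (Quot.mk _ ⟨(i₀, k₀), pt i₀ k₀⟩) (fun k x => Quot.mk _ ⟨(i, k), x⟩)
        fun k => wedge_base (ι := ι × κ) (X := fun p => X p.1 p.2) (pt := fun p => pt p.1 p.2)
          (i, k) (i₀, k₀))
      fun i => wedge_base (ι := ι × κ) (X := fun p => X p.1 p.2) (pt := fun p => pt p.1 p.2)
          (i, k₀) (i₀, k₀)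
  let g : WedgeFam (ι × κ) (fun p => X p.1 p.2) (fun p => pt p.1 p.2) →
      WedgeFam ι (fun i => WedgeFam κ (X i) (pt i)) (fun i => Quot.mk _ ⟨k₀, pt i k₀⟩) :=
    wedgeDesc (Quot.mk _ ⟨i₀, Quot.mk _ ⟨k₀, pt i₀ k₀⟩⟩)
      (fun p x => Quot.mk _ ⟨p.1, Quot.mk _ ⟨p.2, x⟩⟩)
      fun p => by
        rw [wedge_base p.2 k₀]
        exact wedge_base (X := fun i => WedgeFam κ (X i) (pt i))
          (pt := fun i => Quot.mk _ ⟨k₀, pt i k₀⟩) p.1 i₀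
  have hf : Continuous f := continuous_wedgeDesc _ _ _ fun i => continuous_wedgeDesc _ _ _ fun k =>
    continuous_wedge_mk (ι := ι × κ) (X := fun p => X p.1 p.2) (pt := fun p => pt p.1 p.2) (i, k)
  have hg : Continuous g := continuous_wedgeDesc _ _ _ fun p =>
    (continuous_wedge_mk (X := fun i => WedgeFam κ (X i) (pt i))
      (pt := fun i => Quot.mk _ ⟨k₀, pt i k₀⟩) p.1).comp
      (continuous_wedge_mk p.2)
  refine PHE.of_homeomorph ⟨⟨f, g, ?_, ?_⟩, hf, hg⟩ rfl
  · rintro ⟨i, ⟨k, x⟩⟩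
    rfl
  · rintro ⟨⟨i, k⟩, x⟩
    rfl

end Wedge

section Telescope

open Classical

theorem continuous_ite_of_closed_cover {X Y : Type*} [TopologicalSpace X] [TopologicalSpace Y]
    {P Q : X → Prop} (hP : IsClosed {x | P x}) (hQ : IsClosed {x | Q x}) (h : ∀ x, P x ∨ Q x)
    {F G : X → Y} (hF : Continuous F) (hG : Continuous G) (hFG : ∀ x, P x → Q x → F x = G x) :
    Continuous fun x => if P x then G x else F x := by
  rw [← continuousOn_univ, ← Set.eq_univ_of_forall (s := {x | P x} ∪ {x | Q x}) h]
  refine ContinuousOn.union_of_isClosed ?_ ?_ hP hQ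
  · exact hG.continuousOn.congr fun x hx => if_pos hx
  · refine hF.continuousOn.congr fun x hx => ?_
    split_ifs with hx'
    · exact (hFG x hx' hx).symm
    · rfl

/-- A pointwise stabilising sequence of continuous maps, locally uniform after pulling back to a
space whose topology detects continuity, has a continuous limit. -/
theorem exists_stable_limit {X A Y : Type*} [TopologicalSpace X] [TopologicalSpace A]
    [TopologicalSpace Y] {q : X → A} (hq : ∀ F : A → Y, Continuous (F ∘ q) → Continuous F)
    (hs : Function.Surjective q) {T : ℕ → A → Prop}
    (hT : ∀ x, ∃ M, ∀ᶠ x' in 𝓝 x, T M (q x')) {g : ℕ → A → Y} (hg : ∀ m, Continuous (g m ∘ q))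
    (hst : ∀ m k x, T m x → g (m + k) x = g m x) :
    ∃ G : A → Y, Continuous G ∧ ∀ m x, T m x → G x = g m x := by
  have hex : ∀ a, ∃ M, T M a := fun a => by
    obtain ⟨x, rfl⟩ := hs a
    obtain ⟨M, hM⟩ := hT x
    exact ⟨M, hM.self_of_nhds⟩
  choose M hM using hex
  have key : ∀ m x, T m x → g (M x) x = g m x := fun m x h => by
    rw [← hst m (M x) x h, ← hst (M x) m x (hM x), add_comm]
  refine ⟨fun a => g (M a) a, hq _ (continuous_iff_continuousAt.2 fun x => ?_), key⟩
  obtain ⟨m, hm⟩ := hT x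
  exact (hg m).continuousAt.congr (hm.mono fun x' h => (key m _ h).symm)

/-- Pointed maps that split the spaces `A n` up to homotopy, one summand `S n` at a time. -/
structure Tower (A S : ℕ → Type) [∀ n, TopologicalSpace (A n)] [∀ n, TopologicalSpace (S n)]
    (a₀ : ∀ n, A n) (s₀ : ∀ n, S n) where
  i : ∀ n, S n → A n
  a : ∀ n, A (n + 1) → A n
  u : ∀ n, A n → S n
  b : ∀ n, A n → A (n + 1)
  closed_a₀ : ∀ n, IsClosed {a₀ n}
  closed_s₀ : ∀ n, IsClosed {s₀ n}
  cont_i : ∀ n, Continuous (i n)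
  cont_a : ∀ n, Continuous (a n)
  cont_u : ∀ n, Continuous (u n)
  cont_b : ∀ n, Continuous (b n)
  i_base : ∀ n, i n (s₀ n) = a₀ n
  a_base : ∀ n, a n (a₀ (n + 1)) = a₀ n
  u_base : ∀ n, u n (a₀ n) = s₀ n
  b_base : ∀ n, b n (a₀ n) = a₀ (n + 1)
  disj : ∀ n x, u n x = s₀ n ∨ b n x = a₀ (n + 1)
  b_i : ∀ n s, b n (i n s) = a₀ (n + 1)
  decomp : ∀ n, PHtpy (a₀ n) (fun x => if u n x = s₀ n then a n (b n x) else i n (u n x)) id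
  u_i : ∀ n, PHtpy (s₀ n) (u n ∘ i n) id
  u_a : ∀ n, ∃ (U : I × A (n + 1) → S n) (B : I × A (n + 1) → A (n + 1)),
    Continuous U ∧ Continuous B ∧ (∀ p, U p = s₀ n ∨ B p = a₀ (n + 1)) ∧
    (∀ y, U (0, y) = u n (a n y)) ∧ (∀ y, B (0, y) = b n (a n y)) ∧
    (∀ y, U (1, y) = s₀ n) ∧ (∀ s, U (s, a₀ (n + 1)) = s₀ n) ∧
    (∀ s, B (s, a₀ (n + 1)) = a₀ (n + 1)) ∧ PHtpy (a₀ (n + 1)) (fun y => B (1, y)) id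

namespace Tower

variable {A S : ℕ → Type} [∀ n, TopologicalSpace (A n)] [∀ n, TopologicalSpace (S n)]
    {a₀ : ∀ n, A n} {s₀ : ∀ n, S n} (D : Tower A S a₀ s₀)

/-- `x` is sent to the base point by `m` successive applications of `b`. -/
def Dies : ℕ → ∀ n, A n → Prop
  | 0, n, x => x = a₀ n
  | m + 1, n, x => Dies m (n + 1) (D.b n x)

theorem Dies.succ {D : Tower A S a₀ s₀} : ∀ {m n : ℕ} {x : A n}, D.Dies m n x → D.Dies (m + 1) n x
  | 0, n, x, h => by
    obtain rfl : x = a₀ n := h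
    exact D.b_base n
  | m + 1, n, x, h => Dies.succ (m := m) h

/-- Composite of the maps `a`. -/
def toZero : ∀ n, A n → A 0
  | 0 => id
  | n + 1 => toZero n ∘ D.a n

theorem continuous_toZero : ∀ n, Continuous (D.toZero n)
  | 0 => continuous_id
  | n + 1 => (continuous_toZero n).comp (D.cont_a n)

theorem toZero_base : ∀ n, D.toZero n (a₀ n) = a₀ 0
  | 0 => rfl
  | n + 1 => by simp [toZero, D.a_base, toZero_base n]

/-- Partial decomposition of `A n` into the summands `S n, …, S (n + m - 1)`. -/
def split : ℕ → ∀ n, A n → WedgeFam ℕ S s₀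
  | 0, _ => fun _ => Quot.mk _ ⟨0, s₀ 0⟩
  | m + 1, n => fun x =>
    if D.u n x = s₀ n then split m (n + 1) (D.b n x) else Quot.mk _ ⟨n, D.u n x⟩

theorem split_base : ∀ m n, D.split m n (a₀ n) = Quot.mk _ ⟨0, s₀ 0⟩
  | 0, _ => rfl
  | m + 1, n => by simp [split, D.u_base, D.b_base, split_base m]

theorem closed_u (n : ℕ) : IsClosed {x | D.u n x = s₀ n} :=
  (D.closed_s₀ n).preimage (D.cont_u n)

theorem closed_b (n : ℕ) : IsClosed {x | D.b n x = a₀ (n + 1)} :=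
  (D.closed_a₀ (n + 1)).preimage (D.cont_b n)

theorem continuous_split : ∀ m n, Continuous (D.split m n)
  | 0, _ => continuous_const
  | m + 1, n => by
    refine continuous_ite_of_closed_cover (D.closed_u n) (D.closed_b n) (D.disj n)
      ((continuous_wedge_mk n).comp (D.cont_u n))
      ((continuous_split m (n + 1)).comp (D.cont_b n)) fun x h h' => ?_
    simp only [h, h', split_base]
    exact wedge_base n 0

theorem split_stable : ∀ m n k x, D.Dies m n x → D.split (m + k) n x = D.split m n x
  | 0, n, k, x, h => by
    obtain rfl : x = a₀ n := h
    simp [split_base]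
  | m + 1, n, k, x, h => by
    rw [Nat.add_right_comm]
    simp only [split]
    rw [split_stable m (n + 1) k _ h]

/-- The inverse of the splitting. -/
def unsplit : WedgeFam ℕ S s₀ → A 0 :=
  wedgeDesc (a₀ 0) (fun k s => D.toZero k (D.i k s)) fun k => by rw [D.i_base, D.toZero_base]

theorem continuous_unsplit : Continuous D.unsplit :=
  continuous_wedgeDesc _ _ _ fun k => (D.continuous_toZero k).comp (D.cont_i k)

/-- First half of a concatenation. -/
def dbl (s : I) : I := Set.projIcc 0 1 zero_le_one (2 * (s : ℝ))

/-- Second half of a concatenation. -/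
def dbl' (s : I) : I := Set.projIcc 0 1 zero_le_one (2 * (s : ℝ) - 1)

theorem continuous_dbl : Continuous dbl := continuous_projIcc.comp (by fun_prop)

theorem continuous_dbl' : Continuous dbl' := continuous_projIcc.comp (by fun_prop)

theorem dbl_zero : dbl 0 = 0 := by simp [dbl]

theorem dbl'_one : dbl' 1 = 1 := by
  rw [dbl', show (2 * ((1 : I) : ℝ) - 1) = 1 by norm_num, Set.projIcc_right]; rfl

theorem dbl_of_eq {s : I} (h : (s : ℝ) = 1 / 2) : dbl s = 1 ∧ dbl' s = 0 := by
  rw [dbl, dbl', h, show (2 * (1 / 2 : ℝ)) = 1 by norm_num, sub_self, Set.projIcc_right,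
    Set.projIcc_left]
  exact ⟨rfl, rfl⟩

/-- Partial homotopies from the composite `unsplit ∘ split` to the identity. -/
def htpy (K : ∀ n, I × A n → A n) : ℕ → ∀ n, I × A n → A 0
  | 0, n => fun p => D.toZero n p.2
  | m + 1, n => fun p =>
    if (p.1 : ℝ) ≤ 1 / 2 then
      if D.u n p.2 = s₀ n then htpy K m (n + 1) (dbl p.1, D.b n p.2)
      else D.toZero n (D.i n (D.u n p.2))
    else D.toZero n (K n (dbl' p.1, p.2))

variable {D}
variable {K : ∀ n, I × A n → A n}
  (K1 : ∀ n x, K n (1, x) = x) (Kb : ∀ n s, K n (s, a₀ n) = a₀ n)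

include Kb in
theorem htpy_base : ∀ m n s, D.htpy K m n (s, a₀ n) = a₀ 0
  | 0, n, s => D.toZero_base n
  | m + 1, n, s => by
    simp [htpy, D.u_base, D.b_base, htpy_base m, Kb, D.toZero_base]

include K1 in
theorem htpy_one : ∀ m n x, D.htpy K m n (1, x) = D.toZero n x
  | 0, n, x => rfl
  | m + 1, n, x => by
    have : ¬ ((1 : ℝ) ≤ 1 / 2) := by norm_num
    simp only [htpy, Set.Icc.coe_one, this, if_false, dbl'_one, K1]

include Kb in
theorem htpy_stable : ∀ m n k p, D.Dies m n p.2 → D.htpy K (m + k) n p = D.htpy K m n p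
  | 0, n, k, (s, x), h => by
    obtain rfl : x = a₀ n := h
    simp [htpy_base Kb]
  | m + 1, n, k, (s, x), h => by
    rw [Nat.add_right_comm]
    simp only [htpy]
    rw [htpy_stable m (n + 1) k (dbl s, D.b n x) h]

theorem htpy_zero : ∀ m n x, D.Dies m n x → D.htpy K m n (0, x) = D.unsplit (D.split m n x)
  | 0, n, x, h => by
    obtain rfl : x = a₀ n := h
    simp only [htpy, split, toZero_base]
    exact ((congrArg (D.toZero 0) (D.i_base 0)).trans (D.toZero_base 0)).symm
  | m + 1, n, x, h => by
    have : ((0 : ℝ) ≤ 1 / 2) := by norm_num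
    simp only [htpy, split, Set.Icc.coe_zero, this, if_true, dbl_zero]
    rw [htpy_zero m (n + 1) (D.b n x) h]
    split_ifs
    · rfl
    · rfl

include K1 Kb in
theorem continuous_htpy (Kc : ∀ n, Continuous (K n))
    (K0 : ∀ n x, K n (0, x) = if D.u n x = s₀ n then D.a n (D.b n x) else D.i n (D.u n x)) :
    ∀ m n, Continuous (D.htpy K m n)
  | 0, n => (D.continuous_toZero n).comp continuous_snd
  | m + 1, n => by
    have ih := continuous_htpy Kc K0 m (n + 1)
    have hdbl := continuous_dbl
    have hdbl' := continuous_dbl'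
    refine Continuous.if_le ?_ ?_ (by fun_prop) continuous_const ?_
    · refine continuous_ite_of_closed_cover ((D.closed_u n).preimage continuous_snd)
        ((D.closed_b n).preimage continuous_snd) (fun p => D.disj n p.2) ?_ ?_ ?_
      · exact (D.continuous_toZero n).comp ((D.cont_i n).comp ((D.cont_u n).comp continuous_snd))
      · have := D.cont_b n
        exact ih.comp (by fun_prop)
      · intro p (h : D.u n p.2 = _) (h' : D.b n p.2 = _)
        simp only [h, h', D.i_base, D.toZero_base, htpy_base Kb]
    · exact (D.continuous_toZero n).comp ((Kc n).comp (by fun_prop))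
    · intro p hp
      rw [(dbl_of_eq hp).1, (dbl_of_eq hp).2, htpy_one K1, K0, apply_ite (D.toZero n)]
      rfl

/-- A tower whose iterated remainders die locally uniformly splits as a wedge. -/
theorem phe_wedge (D : Tower A S a₀ s₀) {X : ℕ → Type} [∀ n, TopologicalSpace (X n)]
    {q : ∀ n, X n → A n} (hq : ∀ n, IsQuotientMap (q n))
    (hT : ∀ n x, ∃ M, ∀ᶠ x' in 𝓝 x, D.Dies M n (q n x')) :
    PHE (a₀ 0) (Quot.mk _ ⟨0, s₀ 0⟩ : WedgeFam ℕ S s₀) := by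
  have hG : ∀ n, ∃ G : A n → WedgeFam ℕ S s₀, Continuous G ∧
      ∀ m x, D.Dies m n x → G x = D.split m n x := fun n =>
    exists_stable_limit (fun F => (hq n).continuous_iff.2) (hq n).surjective (hT n)
      (fun m => (D.continuous_split m n).comp (hq n).continuous)
      (fun m k x => D.split_stable m n k x)
  choose G Gc Gs using hG
  have Gb : ∀ n, G n (a₀ n) = Quot.mk _ ⟨0, s₀ 0⟩ := fun n => by
    rw [Gs n 0 (a₀ n) rfl]; rfl
  have hex : ∀ n a, ∃ M, D.Dies M n a := fun n a => by
    obtain ⟨x, rfl⟩ := (hq n).surjective a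
    obtain ⟨M, hM⟩ := hT n x
    exact ⟨M, hM.self_of_nhds⟩
  have Grec : ∀ n x, G n x = if D.u n x = s₀ n then G (n + 1) (D.b n x)
      else Quot.mk _ ⟨n, D.u n x⟩ := fun n x => by
    obtain ⟨M, hM⟩ := hex n x
    rw [Gs n (M + 1) x hM.succ, Gs (n + 1) M (D.b n x) hM.succ]
    rfl
  have claim1 : ∀ n, PHtpy (a₀ n) (G 0 ∘ D.toZero n) (G n) := by
    intro n
    induction n with
    | zero => exact .refl (Gc 0)
    | succ n ih =>
      refine (ih.precomp (D.cont_a n) (D.a_base n)).trans ?_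
      obtain ⟨U, B, Uc, Bc, hUB, U0, B0, U1, Ub, Bb, hB⟩ := D.u_a n
      refine PHtpy.trans ?_ (hB.postcomp (Gc (n + 1)))
      refine ⟨fun p => if U p = s₀ n then G (n + 1) (B p) else Quot.mk _ ⟨n, U p⟩, ?_,
        fun y => ?_, fun y => ?_, fun s => ?_⟩
      · refine continuous_ite_of_closed_cover ((D.closed_s₀ n).preimage Uc)
          ((D.closed_a₀ (n + 1)).preimage Bc) hUB ((continuous_wedge_mk n).comp Uc)
          ((Gc (n + 1)).comp Bc) ?_
        intro p (h : U p = _) (h' : B p = _)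
        simp only [h, h', Gb]
        exact wedge_base n 0
      · simp only [Function.comp, U0, B0]
        exact (Grec n (D.a n y)).symm
      · simp [U1]
      · simp only [Ub, Bb, if_true, Function.comp, Gb, D.a_base]
  have claim2 : ∀ n, PHtpy (s₀ n) (G n ∘ D.i n) (fun s => Quot.mk _ ⟨n, s⟩) := by
    intro n
    have := (D.u_i n).postcomp (continuous_wedge_mk (pt := s₀) n)
    refine (congrArg (fun f => PHtpy (s₀ n) f _) (funext fun s => ?_)).mpr this
    simp only [Function.comp]
    rw [Grec, D.b_i, Gb]
    split_ifs with h
    · rw [h]; exact wedge_base 0 n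
    · rfl
  choose K Kc K0 K1 Kb using D.decomp
  have Kb' : ∀ n s, K n (s, a₀ n) = a₀ n := fun n s => by
    simp [Kb, D.u_base, D.b_base, D.a_base]
  obtain ⟨H, Hc, Hs⟩ := exists_stable_limit (X := I × X 0) (q := Prod.map id (q 0))
    (T := fun m p => D.Dies m 0 p.2) (g := fun m => D.htpy K m 0)
    (fun F hF => (hq 0).continuous_lift_prod_right hF)
    (Function.surjective_id.prodMap (hq 0).surjective)
    (fun p => (hT 0 p.2).imp fun M hM => continuous_snd.continuousAt.eventually hM)
    (fun m => (continuous_htpy K1 Kb' Kc K0 m 0).comp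
      (continuous_id.prodMap (hq 0).continuous))
    (fun m k p h => htpy_stable Kb' m 0 k p h)
  refine ⟨G 0, D.unsplit, Gc 0, D.continuous_unsplit, Gb 0, ?_, ?_, ?_⟩
  · exact (congrArg (D.toZero 0) (D.i_base 0)).trans (D.toZero_base 0)
  · refine ⟨H, Hc, fun x => ?_, fun x => ?_, fun s => ?_⟩
    · obtain ⟨M, hM⟩ := hex 0 x
      rw [Hs M (0, x) hM, htpy_zero M 0 x hM, Function.comp, Gs 0 M x hM]
    · obtain ⟨M, hM⟩ := hex 0 x
      rw [Hs M (1, x) hM, htpy_one K1]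
      rfl
    · rw [Hs 0 (s, a₀ 0) rfl, Function.comp, Gb]
      exact (D.toZero_base 0).trans
        ((congrArg (D.toZero 0) (D.i_base 0)).trans (D.toZero_base 0)).symm
  · refine PHtpy.wedge 0 fun k => ?_
    exact ((claim1 k).precomp (D.cont_i k) (D.i_base k)).trans (claim2 k)

end Tower

end Telescope

/-- `q` is the quotient map that collapses the nonempty set `O` to the point `a₀`. -/
structure IsCollapse {X A : Type*} [TopologicalSpace X] [TopologicalSpace A] (q : X → A)
    (O : X → Prop) (a₀ : A) : Prop where
  quot : IsQuotientMap q
  base_iff : ∀ x, q x = a₀ ↔ O x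
  inj : ∀ x y, q x = q y → ¬ O x → x = y

namespace IsCollapse

variable {X A Y : Type*} [TopologicalSpace X] [TopologicalSpace A] [TopologicalSpace Y]
  {q : X → A} {O : X → Prop} {a₀ : A} (h : IsCollapse q O a₀)

include h

/-- The map on the quotient induced by a map that is constant on the collapsed set. -/
def desc (F : X → Y) : A → Y := F ∘ Function.surjInv h.quot.surjective

omit [TopologicalSpace Y] in
theorem desc_apply {F : X → Y} {y₀ : Y} (hF : ∀ x, O x → F x = y₀) (x : X) :
    h.desc F (q x) = F x := by
  have e : q (Function.surjInv h.quot.surjective (q x)) = q x := Function.surjInv_eq _ _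
  by_cases hx : O x
  · have : q (Function.surjInv h.quot.surjective (q x)) = a₀ := e.trans ((h.base_iff x).2 hx)
    exact (hF _ ((h.base_iff _).1 this)).trans (hF x hx).symm
  · exact congrArg F (h.inj _ _ e.symm hx).symm

theorem continuous_desc {F : X → Y} {y₀ : Y} (hF : ∀ x, O x → F x = y₀) (hc : Continuous F) :
    Continuous (h.desc F) :=
  h.quot.continuous_iff.2 (hc.congr fun x => (h.desc_apply hF x).symm)

omit [TopologicalSpace Y] in
theorem desc_base {F : X → Y} {y₀ : Y} (hF : ∀ x, O x → F x = y₀) : h.desc F a₀ = y₀ := by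
  obtain ⟨x, hx⟩ := h.quot.surjective a₀
  have := (h.desc_apply hF x).trans (hF x ((h.base_iff x).1 hx))
  rwa [hx] at this

theorem exists_lift {F : I × X → Y} {y₀ : Y} (hF : ∀ s x, O x → F (s, x) = y₀)
    (hc : Continuous F) : ∃ G : I × A → Y, Continuous G ∧ (∀ s x, G (s, q x) = F (s, x)) ∧
      ∀ s, G (s, a₀) = y₀ := by
  have key : ∀ s x, h.desc (fun x => F (s, x)) (q x) = F (s, x) :=
    fun s x => h.desc_apply (hF s) x
  refine ⟨fun p => h.desc (fun x => F (p.1, x)) p.2, h.quot.continuous_lift_prod_right ?_, key,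
    fun s => h.desc_base (hF s)⟩
  exact hc.congr fun p => (key p.1 p.2).symm

theorem phtpy {F : I × X → Y} {y₀ : Y} (hF : ∀ s x, O x → F (s, x) = y₀)
    (hc : Continuous F) {f g : A → Y} (hf : ∀ x, F (0, x) = f (q x))
    (hg : ∀ x, F (1, x) = g (q x)) : PHtpy a₀ f g := by
  obtain ⟨G, Gc, Gq, Gb⟩ := h.exists_lift hF hc
  have h0 : ∀ a, G (0, a) = f a := fun a => by
    obtain ⟨x, rfl⟩ := h.quot.surjective a
    rw [Gq, hf]
  refine ⟨G, Gc, h0, fun a => ?_, fun s => by rw [Gb, ← h0, Gb]⟩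
  obtain ⟨x, rfl⟩ := h.quot.surjective a
  rw [Gq, hg]

theorem isClosed_base (hO : IsClosed {x | O x}) : IsClosed {a₀} := by
  rw [← h.quot.isClosed_preimage]
  convert hO using 1
  ext x
  simp [h.base_iff]

end IsCollapse

section Cube

/-- The complement of the open unit cube. -/
def Outside {d : ℕ} (z : Fin d → ℝ) : Prop := ∃ i, 1 ≤ |z i|

theorem outside_cons {d : ℕ} {t : ℝ} {z : Fin d → ℝ} :
    Outside (Fin.cons t z : Fin (d + 1) → ℝ) ↔ 1 ≤ |t| ∨ Outside z := by
  simp [Outside, Fin.exists_fin_succ]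

theorem isClosed_outside (d : ℕ) : IsClosed {z : Fin d → ℝ | Outside z} := by
  simp only [Outside, Set.ofPred_exists]
  exact isClosed_iUnion_of_finite fun i => isClosed_le continuous_const (by fun_prop)

theorem not_outside_iff {d : ℕ} {z : Fin d → ℝ} : ¬ Outside z ↔ ‖z‖ < 1 := by
  simp [Outside, pi_norm_lt_iff, Real.norm_eq_abs]

variable {d : ℕ}

/-- Distance to the boundary of the cube. -/
def cubeGap (z : Fin d → ℝ) : ℝ := max 0 (1 - ‖z‖)

theorem cubeGap_eq_zero {z : Fin d → ℝ} : cubeGap z = 0 ↔ Outside z := by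
  rw [← not_iff_not, not_outside_iff, cubeGap]
  constructor
  · intro h
    by_contra h'
    exact h (max_eq_left (by linarith))
  · intro h
    exact (lt_max_of_lt_right (by linarith)).ne'

theorem cubeGap_nonneg (z : Fin d → ℝ) : 0 ≤ cubeGap z := le_max_left _ _

theorem cube_denom_pos (z : Fin d → ℝ) : 0 < ∑ i, z i ^ 2 + cubeGap z ^ 2 := by
  have h0 : 0 ≤ ∑ i, z i ^ 2 := Finset.sum_nonneg fun i _ => sq_nonneg _
  rcases (cubeGap_nonneg z).eq_or_lt with h | h
  · obtain ⟨i, hi⟩ := cubeGap_eq_zero.1 h.symm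
    have : z i ^ 2 ≤ ∑ i, z i ^ 2 :=
      Finset.single_le_sum (f := fun i => z i ^ 2) (fun i _ => sq_nonneg _) (Finset.mem_univ i)
    have h1 : 1 ≤ z i ^ 2 := by rw [← sq_abs]; nlinarith
    have := sq_nonneg (cubeGap z)
    linarith
  · positivity

/-- The map from `ℝᵈ` onto the sphere that collapses the outside of the unit cube. -/
def cubeMap (z : Fin d → ℝ) : SphereSp d :=
  ⟨WithLp.toLp 2 (Fin.cons ((∑ i, z i ^ 2 - cubeGap z ^ 2) / (∑ i, z i ^ 2 + cubeGap z ^ 2))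
    (fun i => 2 * cubeGap z * z i / (∑ i, z i ^ 2 + cubeGap z ^ 2))), by
    have h := cube_denom_pos z
    rw [mem_sphere_zero_iff_norm, ← sq_eq_sq₀ (norm_nonneg _) zero_le_one,
      EuclideanSpace.real_norm_sq_eq, Fin.sum_univ_succ]
    simp only [Fin.cons_zero, Fin.cons_succ, div_pow, mul_pow]
    rw [← Finset.sum_div, ← Finset.mul_sum]
    field_simp
    ring⟩

theorem continuous_cubeGap : Continuous (cubeGap (d := d)) := by
  unfold cubeGap
  fun_prop

theorem continuous_cubeMap : Continuous (cubeMap (d := d)) := by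
  have := continuous_cubeGap (d := d)
  have h := fun z : Fin d → ℝ => (cube_denom_pos z).ne'
  refine Continuous.subtype_mk ((PiLp.continuous_toLp 2 _).comp ?_) _
  refine continuous_pi fun j => ?_
  refine Fin.cases ?_ (fun i => ?_) j
  · simp only [Fin.cons_zero]
    fun_prop (disch := assumption)
  · simp only [Fin.cons_succ]
    fun_prop (disch := assumption)

theorem cubeMap_zero_coord (z : Fin d → ℝ) : (cubeMap z).1 0 =
    (∑ i, z i ^ 2 - cubeGap z ^ 2) / (∑ i, z i ^ 2 + cubeGap z ^ 2) := rfl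

theorem cubeMap_succ_coord (z : Fin d → ℝ) (i : Fin d) : (cubeMap z).1 i.succ =
    2 * cubeGap z * z i / (∑ i, z i ^ 2 + cubeGap z ^ 2) := rfl

theorem one_sub_cubeMap (z : Fin d → ℝ) :
    1 - (cubeMap z).1 0 = 2 * cubeGap z ^ 2 / (∑ i, z i ^ 2 + cubeGap z ^ 2) := by
  have h := (cube_denom_pos z).ne'
  rw [cubeMap_zero_coord]
  field_simp
  ring

theorem sphere_eq_iff {x y : SphereSp d} :
    x = y ↔ x.1 0 = y.1 0 ∧ ∀ i : Fin d, x.1 i.succ = y.1 i.succ := by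
  refine ⟨by rintro rfl; simp, fun h => Subtype.ext (PiLp.ext fun j => ?_)⟩
  refine Fin.cases h.1 h.2 j

theorem cubeMap_eq_base (z : Fin d → ℝ) : cubeMap z = spherePt d ↔ Outside z := by
  rw [← cubeGap_eq_zero]
  have h := (cube_denom_pos z).ne'
  constructor
  · intro e
    have := one_sub_cubeMap z
    rw [e, show (spherePt d).1 0 = 1 by simp [spherePt], sub_self, eq_comm, div_eq_zero_iff] at this
    simpa [h] using this
  · intro e
    refine sphere_eq_iff.2 ⟨?_, fun i => ?_⟩
    · rw [cubeMap_zero_coord, e]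
      rw [e] at h
      simp only [spherePt, PiLp.single_apply, if_true]
      field_simp
      ring
    · rw [cubeMap_succ_coord, e]
      simp [spherePt]

theorem cubeMap_inj {z w : Fin d → ℝ} (h : cubeMap z = cubeMap w) (hz : ¬ Outside z) : z = w := by
  have hw : ¬ Outside w := fun h' => hz ((cubeMap_eq_base z).1 (h.trans ((cubeMap_eq_base w).2 h')))
  have gz := (cubeGap_nonneg z).lt_of_ne' (mt cubeGap_eq_zero.1 hz)
  have gw := (cubeGap_nonneg w).lt_of_ne' (mt cubeGap_eq_zero.1 hw)
  have dz := cube_denom_pos z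
  have dw := cube_denom_pos w
  have key : ∀ i, cubeGap w * z i = cubeGap z * w i := fun i => by
    have e1 : (cubeMap z).1 i.succ * (1 - (cubeMap w).1 0) =
      (cubeMap w).1 i.succ * (1 - (cubeMap z).1 0) := by rw [h]
    rw [one_sub_cubeMap, one_sub_cubeMap, cubeMap_succ_coord, cubeMap_succ_coord] at e1
    field_simp at e1
    linarith
  have key2 : cubeGap w * ‖z‖ = cubeGap z * ‖w‖ := by
    have : cubeGap w • z = cubeGap z • w := funext key
    have := congrArg norm this
    rwa [norm_smul, norm_smul, Real.norm_of_nonneg gz.le, Real.norm_of_nonneg gw.le] at this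
  rw [not_outside_iff] at hz hw
  have ez : cubeGap z = 1 - ‖z‖ := max_eq_right (by linarith)
  have ew : cubeGap w = 1 - ‖w‖ := max_eq_right (by linarith)
  have : ‖z‖ = ‖w‖ := by
    rw [ez, ew] at key2
    linarith
  have eg : cubeGap z = cubeGap w := by rw [ez, ew, this]
  funext i
  have := key i
  rw [eg] at this
  exact mul_left_cancel₀ gw.ne' this

theorem cubeMap_surj_ball (hd : 0 < d) (y : SphereSp d) :
    ∃ z ∈ Metric.closedBall (0 : Fin d → ℝ) 1, cubeMap z = y := by
  have : Nonempty (Fin d) := ⟨⟨0, hd⟩⟩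
  by_cases hy : y = spherePt d
  · refine ⟨fun _ => 1, ?_, ?_⟩
    · simp [pi_norm_const]
    · rw [hy, cubeMap_eq_base]
      exact ⟨⟨0, hd⟩, by simp⟩
  have hn : y.1 0 ^ 2 + ∑ i : Fin d, y.1 i.succ ^ 2 = 1 := by
    rw [← Fin.sum_univ_succ (f := fun i => y.1 i ^ 2), ← EuclideanSpace.real_norm_sq_eq,
      mem_sphere_zero_iff_norm.1 y.2, one_pow]
  have hS : 0 ≤ ∑ i : Fin d, y.1 i.succ ^ 2 := Finset.sum_nonneg fun i _ => sq_nonneg _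
  have h1 : 0 < 1 - y.1 0 := by
    by_contra hc
    have hc' : 1 ≤ y.1 0 := by linarith
    have e0 : y.1 0 = 1 := by nlinarith
    have e1 : ∑ i : Fin d, y.1 i.succ ^ 2 = 0 := by rw [e0] at hn; linarith
    rw [Finset.sum_eq_zero_iff_of_nonneg fun i _ => sq_nonneg _] at e1
    refine hy (sphere_eq_iff.2 ⟨by simp [e0, spherePt], fun i => ?_⟩)
    have := e1 i (Finset.mem_univ i)
    simp only [spherePt, PiLp.single_apply, Fin.succ_ne_zero, if_false]
    exact pow_eq_zero_iff two_ne_zero |>.1 this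
  set w : Fin d → ℝ := fun i => y.1 i.succ / (1 - y.1 0) with hw
  have hw0 : 0 < 1 + ‖w‖ := by positivity
  have hz : ‖(1 + ‖w‖)⁻¹ • w‖ = ‖w‖ / (1 + ‖w‖) := by
    rw [norm_smul, Real.norm_of_nonneg (by positivity), inv_mul_eq_div]
  have hg : cubeGap ((1 + ‖w‖)⁻¹ • w) = (1 + ‖w‖)⁻¹ := by
    have : 1 - ‖w‖ / (1 + ‖w‖) = (1 + ‖w‖)⁻¹ := by field_simp; ring
    rw [cubeGap, hz, this, max_eq_right (by positivity)]
  have hsum : ∑ i, ((1 + ‖w‖)⁻¹ • w) i ^ 2 =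
      (1 + ‖w‖)⁻¹ ^ 2 * ((1 + y.1 0) / (1 - y.1 0)) := by
    have : ∑ i, w i ^ 2 = (1 + y.1 0) / (1 - y.1 0) := by
      simp only [hw, div_pow]
      rw [← Finset.sum_div, show ∑ i : Fin d, y.1 i.succ ^ 2 = (1 + y.1 0) * (1 - y.1 0) by
        linarith]
      field_simp
    simp only [Pi.smul_apply, smul_eq_mul, mul_pow]
    rw [← Finset.mul_sum, this]
  have hden : ∑ i, ((1 + ‖w‖)⁻¹ • w) i ^ 2 + cubeGap ((1 + ‖w‖)⁻¹ • w) ^ 2 =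
      (1 + ‖w‖)⁻¹ ^ 2 * (2 / (1 - y.1 0)) := by
    rw [hsum, hg]
    field_simp
    ring
  refine ⟨(1 + ‖w‖)⁻¹ • w, ?_, ?_⟩
  · rw [mem_closedBall_zero_iff, hz, div_le_one hw0]
    linarith
  · refine sphere_eq_iff.2 ⟨?_, fun i => ?_⟩
    · rw [cubeMap_zero_coord, hden, hsum, hg]
      field_simp
      ring
    · rw [cubeMap_succ_coord, hden, hg]
      simp only [Pi.smul_apply, smul_eq_mul, hw]
      field_simp

/-- The map from `ℝᵈ × Y` onto the half-smash `Sᵈ ⋊ Y`. -/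
def cls {Y : Type*} [TopologicalSpace Y] (p : (Fin d → ℝ) × Y) :
    HalfSmash (SphereSp d) Y (spherePt d) :=
  Quot.mk _ (cubeMap p.1, p.2)

theorem isCollapse_cubeMap (hd : 0 < d) :
    IsCollapse (cubeMap (d := d)) Outside (spherePt d) where
  quot := by
    let g : Metric.closedBall (0 : Fin d → ℝ) 1 → SphereSp d := fun z => cubeMap z.1
    have hg : Continuous g := continuous_cubeMap.comp continuous_subtype_val
    have hs : Function.Surjective g := fun y => by
      obtain ⟨z, hz, rfl⟩ := cubeMap_surj_ball hd y
      exact ⟨⟨z, hz⟩, rfl⟩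
    have : IsQuotientMap g := hg.isClosedMap.isQuotientMap hg hs
    exact IsQuotientMap.of_comp continuous_subtype_val continuous_cubeMap this
  base_iff := cubeMap_eq_base
  inj _ _ := cubeMap_inj

theorem isCollapse_cls {Y : Type*} [TopologicalSpace Y] [Nonempty Y] (hd : 0 < d) (y₀ : Y) :
    IsCollapse (cls (d := d) (Y := Y)) (fun p => Outside p.1) (Quot.mk _ (spherePt d, y₀)) := by
  have hmk : ∀ u v : SphereSp d × Y,
      (Quot.mk _ u : HalfSmash (SphereSp d) Y (spherePt d)) = Quot.mk _ v ↔
        u = v ∨ (u.1 = spherePt d ∧ v.1 = spherePt d) := fun u v => by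
    constructor
    · intro h
      have := Quot.eqvGen_exact h
      induction this with
      | rel _ _ h' => exact .inr h'
      | refl => exact .inl rfl
      | symm x y h1 h2 => rcases h2 (Quot.eqvGen_sound h1) with h | h <;> simp [h]
      | trans x y z h1 h2 ih1 ih2 =>
        rcases ih1 (Quot.eqvGen_sound h1) with rfl | h <;>
        rcases ih2 (Quot.eqvGen_sound h2) with rfl | h' <;> simp [*]
    · rintro (rfl | h)
      · rfl
      · exact Quot.sound h
  refine ⟨?_, fun p => ?_, fun p p' h hp => ?_⟩
  · let g : Metric.closedBall (0 : Fin d → ℝ) 1 → SphereSp d := fun z => cubeMap z.1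
    have hg : Continuous g := continuous_cubeMap.comp continuous_subtype_val
    have hs : Function.Surjective g := fun y => by
      obtain ⟨z, hz, rfl⟩ := cubeMap_surj_ball hd y
      exact ⟨⟨z, hz⟩, rfl⟩
    have hp : IsProperMap (Prod.map g (id : Y → Y)) := hg.isProperMap.prodMap isProperMap_id
    have h1 : IsQuotientMap (Prod.map g (id : Y → Y)) :=
      hp.isClosedMap.isQuotientMap hp.continuous (hs.prodMap Function.surjective_id)
    have h2 : IsQuotientMap (Prod.map (cubeMap (d := d)) (id : Y → Y)) :=
      IsQuotientMap.of_comp (f := Prod.map (Subtype.val :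
        Metric.closedBall (0 : Fin d → ℝ) 1 → _) (id : Y → Y)) (by fun_prop)
        (continuous_cubeMap.prodMap continuous_id) h1
    exact isQuotientMap_quot_mk.comp h2
  · rw [cls, hmk, ← cubeMap_eq_base]
    simp only [Prod.mk.injEq, and_true]
    tauto
  · rw [cls, cls, hmk, Prod.mk.injEq] at h
    rcases h with h | h
    · exact Prod.ext (cubeMap_inj h.1 hp) h.2
    · exact absurd ((cubeMap_eq_base _).1 h.1) hp

end Cube

section Paths

/-- Truncation of a real number to the unit interval. -/
def clamp (r : ℝ) : ℝ := max 0 (min 1 r)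

theorem clamp_nonneg (r : ℝ) : 0 ≤ clamp r := le_max_left _ _

theorem clamp_le_one (r : ℝ) : clamp r ≤ 1 := max_le zero_le_one (min_le_left _ _)

theorem clamp_of_le {r : ℝ} (h : r ≤ 0) : clamp r = 0 := by
  rw [clamp, max_eq_left ((min_le_right _ _).trans h)]

theorem clamp_of_ge {r : ℝ} (h : 1 ≤ r) : clamp r = 1 := by
  rw [clamp, min_eq_left h, max_eq_right zero_le_one]

theorem clamp_of_mem {r : ℝ} (h : 0 ≤ r) (h' : r ≤ 1) : clamp r = r := by
  rw [clamp, min_eq_right h', max_eq_right h]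

@[fun_prop]
theorem continuous_clamp : Continuous clamp := by
  unfold clamp
  fun_prop

/-- Euclidean space with its height coordinate singled out. -/
abbrev Space3 : Type := (ℝ × ℝ) × ℝ

/-- The base point. -/
def basePt : Space3 := ((1, 0), 0)

theorem norm_basePt_fst : ‖basePt.1‖ = 1 := by simp [basePt, Prod.norm_def]

/-- Paths in the punctured space that end at the base point and start outside a cone around the
vertical axis. -/
abbrev PathSp : Type :=
  {γ : C(I, Space3) // (∀ s, γ s ≠ 0) ∧ γ 1 = basePt ∧ (γ 0).2 < 2 * ‖(γ 0).1‖}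

/-- Evaluation of a path, extended to all reals by constants. -/
def ev (γ : PathSp) (r : ℝ) : Space3 := γ.1 (Set.projIcc 0 1 zero_le_one r)

@[fun_prop]
theorem Continuous.ev {Y : Type*} [TopologicalSpace Y] {γ : Y → PathSp} {r : Y → ℝ}
    (hγ : Continuous γ) (hr : Continuous r) : Continuous fun y => ev (γ y) (r y) := by
  have h1 : Continuous fun y => (γ y).1 := continuous_subtype_val.comp hγ
  have h2 : Continuous fun y => Set.projIcc (0 : ℝ) 1 zero_le_one (r y) :=
    continuous_projIcc.comp hr
  exact h1.eval h2

theorem ev_ne (γ : PathSp) (r : ℝ) : ev γ r ≠ 0 := γ.2.1 _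

theorem ev_of_ge (γ : PathSp) {r : ℝ} (h : 1 ≤ r) : ev γ r = basePt := by
  rw [ev, Set.projIcc_of_right_le _ h]
  exact γ.2.2.1

theorem ev_of_le (γ : PathSp) {r : ℝ} (h : r ≤ 0) : ev γ r = ev γ 0 := by
  rw [ev, ev, Set.projIcc_of_le_left _ h, Set.projIcc_of_le_left _ le_rfl]

theorem ev_zero_lt (γ : PathSp) : (ev γ 0).2 < 2 * ‖(ev γ 0).1‖ := by
  have := γ.2.2.2
  rwa [ev, Set.projIcc_of_le_left _ le_rfl]

theorem ev_coe (γ : PathSp) (s : I) : ev γ s = γ.1 s := by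
  rw [ev, Set.projIcc_val]

/-- The condition on a function for its restriction to the unit interval to be in `PathSp`. -/
structure Good (φ : ℝ → Space3) : Prop where
  cont : ContinuousOn φ (Set.Icc 0 1)
  ne : ∀ s, 0 ≤ s → s ≤ 1 → φ s ≠ 0
  one : φ 1 = basePt
  zero : (φ 0).2 < 2 * ‖(φ 0).1‖

/-- The path given by a function on the reals. -/
def Good.path {φ : ℝ → Space3} (h : Good φ) : PathSp :=
  ⟨⟨fun s : I => φ s, continuousOn_iff_continuous_domRestrict.1 h.cont⟩,
    fun s => h.ne s s.2.1 s.2.2, h.one, h.zero⟩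

theorem Good.ev_path {φ : ℝ → Space3} (h : Good φ) (r : ℝ) : ev h.path r = φ (clamp r) := rfl

theorem Good.congr {φ ψ : ℝ → Space3} (h : Good φ) (e : ∀ s, 0 ≤ s → s ≤ 1 → φ s = ψ s) :
    Good ψ where
  cont := h.cont.congr fun s hs => (e s hs.1 hs.2).symm
  ne s h0 h1 := e s h0 h1 ▸ h.ne s h0 h1
  one := (e 1 zero_le_one le_rfl).symm.trans h.one
  zero := e 0 le_rfl zero_le_one ▸ h.zero

theorem good_ev (γ : PathSp) : Good (ev γ) where
  cont := Continuous.continuousOn (by fun_prop)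
  ne s _ _ := ev_ne γ s
  one := ev_of_ge γ le_rfl
  zero := ev_zero_lt γ

theorem path_good_ev (γ : PathSp) : (good_ev γ).path = γ :=
  Subtype.ext (ContinuousMap.ext fun s => ev_coe γ s)

theorem good_const : Good fun _ => basePt where
  cont := continuousOn_const
  ne _ _ _ := by simp [basePt]
  one := rfl
  zero := by simp [basePt]

/-- The constant path. -/
def constPath : PathSp := good_const.path

theorem ev_constPath (r : ℝ) : ev constPath r = basePt := rfl

variable {d : ℕ}

/-- The half-smash of a sphere with the space of paths. -/
abbrev PathSmash (d : ℕ) : Type := HalfSmash (SphereSp d) PathSp (spherePt d)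

/-- The base point of the half-smash. -/
def smashPt (d : ℕ) : PathSmash d := Quot.mk _ (spherePt d, constPath)

theorem collapse_cls (d : ℕ) :
    IsCollapse (cls (d := d + 1) (Y := PathSp)) (fun p => Outside p.1) (smashPt (d + 1)) :=
  have : Nonempty PathSp := ⟨constPath⟩
  isCollapse_cls d.succ_pos constPath

open Classical in
/-- The point of the half-smash given by a point of the cube and a path. -/
def pcls (z : Fin d → ℝ) (φ : ℝ → Space3) : PathSmash d :=
  if h : Good φ then cls (z, h.path) else smashPt d

theorem cls_outside {z : Fin d → ℝ} (hz : Outside z) (γ : PathSp) : cls (z, γ) = smashPt d :=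
  Quot.sound ⟨(cubeMap_eq_base z).2 hz, rfl⟩

theorem pcls_outside {z : Fin d → ℝ} (hz : Outside z) (φ : ℝ → Space3) :
    pcls z φ = smashPt d := by
  rw [pcls]
  split_ifs
  · exact cls_outside hz _
  · rfl

theorem Good.pcls_eq {φ : ℝ → Space3} (h : Good φ) (z : Fin d → ℝ) :
    pcls z φ = cls (z, h.path) := dif_pos h

theorem pcls_congr (z : Fin d → ℝ) {φ ψ : ℝ → Space3} (e : ∀ s, 0 ≤ s → s ≤ 1 → φ s = ψ s) :
    pcls z φ = pcls z ψ := by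
  by_cases h : Good φ
  · rw [h.pcls_eq, (h.congr e).pcls_eq]
    congr 2
    exact Subtype.ext (ContinuousMap.ext fun s => e s s.2.1 s.2.2)
  · have h' : ¬ Good ψ := fun h' => h (h'.congr fun s h0 h1 => (e s h0 h1).symm)
    rw [pcls, pcls, dif_neg h, dif_neg h']

theorem pcls_ev (z : Fin d → ℝ) (γ : PathSp) : pcls z (ev γ) = cls (z, γ) := by
  rw [(good_ev γ).pcls_eq, path_good_ev]

theorem continuous_cls : Continuous (cls (d := d) (Y := PathSp)) :=
  continuous_quot_mk.comp (continuous_cubeMap.prodMap continuous_id)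

theorem continuous_pcls {Y : Type*} [TopologicalSpace Y] {z : Y → Fin d → ℝ}
    {φ : Y → ℝ → Space3} (hz : Continuous z) (hφ : Continuous fun p : Y × ℝ => φ p.1 p.2)
    (h1 : ∀ y, φ y 1 = basePt)
    (h : ∀ y, ((∀ s, 0 ≤ s → s ≤ 1 → φ y s ≠ 0) ∧ (φ y 0).2 < 2 * ‖(φ y 0).1‖) ∨
      ∃ i, 1 < |z y i|) : Continuous fun y => pcls (z y) (φ y) := by
  let w : Y → C(I, Space3) := fun y => ⟨fun s => φ y s, by fun_prop⟩
  have hw : Continuous w := ContinuousMap.continuous_of_continuous_uncurry _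
    (hφ.comp (f := fun p : Y × I => (p.1, (p.2 : ℝ))) (by fun_prop))
  have hV : IsOpen {y | Set.MapsTo (w y) Set.univ {0}ᶜ ∧ (φ y 0).2 < 2 * ‖(φ y 0).1‖} := by
    have c0 : Continuous fun y => φ y 0 := hφ.comp (f := fun y => (y, (0 : ℝ))) (by fun_prop)
    refine IsOpen.inter ?_ (isOpen_lt (f := fun y => (φ y 0).2)
      (g := fun y => 2 * ‖(φ y 0).1‖) (by fun_prop) (by fun_prop))
    exact (ContinuousMap.isOpen_setOfPred_mapsTo isCompact_univ isOpen_compl_singleton).preimage hw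
  have hO : IsOpen {y | ∃ i, 1 < |z y i|} := by
    simp only [Set.ofPred_exists]
    exact isOpen_iUnion fun i => isOpen_lt continuous_const (by fun_prop)
  refine continuous_iff_continuousAt.2 fun y => ?_
  rcases h y with hy | hy
  · have hy' : y ∈ {y | Set.MapsTo (w y) Set.univ {0}ᶜ ∧ (φ y 0).2 < 2 * ‖(φ y 0).1‖} :=
      ⟨fun s _ => hy.1 s s.2.1 s.2.2, hy.2⟩
    refine ContinuousOn.continuousAt ?_ (hV.mem_nhds hy')
    rw [continuousOn_iff_continuous_domRestrict]
    have hg : ∀ y ∈ {y | Set.MapsTo (w y) Set.univ {0}ᶜ ∧ (φ y 0).2 < 2 * ‖(φ y 0).1‖},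
        Good (φ y) := fun y hy =>
      ⟨Continuous.continuousOn (by fun_prop), fun s h0 h1 => hy.1 (x := ⟨s, h0, h1⟩) trivial,
        h1 y, hy.2⟩
    have : Continuous fun y : {y | Set.MapsTo (w y) Set.univ {0}ᶜ ∧
        (φ y 0).2 < 2 * ‖(φ y 0).1‖} => cls (z y.1, (hg y.1 y.2).path) := by
      refine continuous_cls.comp (Continuous.prodMk (by fun_prop) ?_)
      exact Continuous.subtype_mk (hw.comp continuous_subtype_val) _
    exact this.congr fun y => ((hg y.1 y.2).pcls_eq _).symm
  · refine ContinuousAt.congr (f := fun _ => smashPt d) continuousAt_const ?_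
    filter_upwards [hO.mem_nhds hy] with y' hy'
    obtain ⟨i, hi⟩ := hy'
    exact (pcls_outside ⟨i, hi.le⟩ _).symm

/-- Prepend two coordinates. -/
def cons2 (v : ℝ × ℝ) (z : Fin d → ℝ) : Fin (d + 2) → ℝ := Fin.cons v.1 (Fin.cons v.2 z)

theorem outside_cons2 {v : ℝ × ℝ} {z : Fin d → ℝ} :
    Outside (cons2 v z) ↔ 1 ≤ ‖v‖ ∨ Outside z := by
  rw [cons2, outside_cons, outside_cons, Prod.norm_def, le_max_iff, or_assoc]
  rfl

@[fun_prop]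
theorem Continuous.consReal {Y : Type*} [TopologicalSpace Y] {t : Y → ℝ} {z : Y → Fin d → ℝ}
    (ht : Continuous t) (hz : Continuous z) :
    Continuous fun y => (Fin.cons (t y) (z y) : Fin (d + 1) → ℝ) :=
  ht.finCons hz

@[fun_prop]
theorem Continuous.cons2 {Y : Type*} [TopologicalSpace Y] {v : Y → ℝ × ℝ} {z : Y → Fin d → ℝ}
    (hv : Continuous v) (hz : Continuous z) : Continuous fun y => cons2 (v y) (z y) := by
  unfold _root_.cons2
  fun_prop

@[fun_prop]
theorem Continuous.tailReal {Y : Type*} [TopologicalSpace Y] {z : Y → Fin (d + 1) → ℝ}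
    (hz : Continuous z) : Continuous fun y => (Fin.tail (z y) : Fin d → ℝ) :=
  continuous_pi fun i => (continuous_apply i.succ).comp hz

/-- Radial coordinate of a point of the upper cone, in which the cone is the open unit square. -/
def coneCoord (x : Space3) : ℝ × ℝ := (2 / ‖x‖) • x.1

theorem continuousOn_coneCoord : ContinuousOn coneCoord {0}ᶜ := by
  have : ContinuousOn (fun x : Space3 => 2 / ‖x‖) {0}ᶜ :=
    continuousOn_const.div continuous_norm.continuousOn fun x hx => norm_ne_zero_iff.2 hx
  exact this.smul continuous_fst.continuousOn

theorem Continuous.coneCoord {Y : Type*} [TopologicalSpace Y] {x : Y → Space3}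
    (hx : Continuous x) (h : ∀ y, x y ≠ 0) : Continuous fun y => coneCoord (x y) :=
  continuousOn_coneCoord.comp_continuous hx h

theorem norm_coneCoord (x : Space3) : ‖coneCoord x‖ = 2 * ‖x.1‖ / ‖x‖ := by
  rw [_root_.coneCoord, norm_smul, Real.norm_of_nonneg (by positivity)]
  ring

theorem norm_space3 (x : Space3) : ‖x‖ = max ‖x.1‖ |x.2| := rfl

theorem one_lt_norm_coneCoord {x : Space3} (h0 : x ≠ 0) (h1 : 0 ≤ x.2) (h2 : x.2 < 2 * ‖x.1‖) :
    1 < ‖coneCoord x‖ := by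
  rw [norm_coneCoord, one_lt_div (norm_pos_iff.2 h0), norm_space3, abs_of_nonneg h1]
  exact max_lt (by linarith) h2

open Classical in
/-- The point of the half-smash given by a point of the upper half space and a path, where points
outside the upper cone are collapsed. -/
def bcls (x : Space3) (z : Fin d → ℝ) (φ : ℝ → Space3) : PathSmash (d + 2) :=
  if 0 < x.2 then pcls (cons2 (coneCoord x) z) φ else smashPt (d + 2)

theorem bcls_of_nonpos {x : Space3} (h : x.2 ≤ 0) (z : Fin d → ℝ) (φ : ℝ → Space3) :
    bcls x z φ = smashPt (d + 2) := if_neg h.not_gt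

theorem bcls_of_lt {x : Space3} (h : x.2 < 2 * ‖x.1‖) (z : Fin d → ℝ) (φ : ℝ → Space3) :
    bcls x z φ = smashPt (d + 2) := by
  rw [bcls]
  split_ifs with h1
  · refine pcls_outside (outside_cons2.2 (.inl (one_lt_norm_coneCoord ?_ h1.le h).le)) _
    rintro rfl
    exact lt_irrefl _ h1
  · rfl

theorem bcls_outside {z : Fin d → ℝ} (hz : Outside z) (x : Space3) (φ : ℝ → Space3) :
    bcls x z φ = smashPt (d + 2) := by
  rw [bcls]
  split_ifs with h1
  · exact pcls_outside (outside_cons2.2 (.inr hz)) _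
  · rfl

theorem bcls_congr (x : Space3) (z : Fin d → ℝ) {φ ψ : ℝ → Space3}
    (e : ∀ s, 0 ≤ s → s ≤ 1 → φ s = ψ s) : bcls x z φ = bcls x z ψ := by
  rw [bcls, bcls, pcls_congr _ e]

/-- Reflection of the height coordinate. -/
def flip3 (x : Space3) : Space3 := (x.1, -x.2)

@[fun_prop]
theorem continuous_flip3 : Continuous flip3 := by
  unfold flip3
  fun_prop

theorem flip3_flip3 (x : Space3) : flip3 (flip3 x) = x := by simp [flip3]

theorem flip3_ne {x : Space3} (h : x ≠ 0) : flip3 x ≠ 0 := by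
  contrapose! h
  rw [← flip3_flip3 x, h]
  simp [flip3]

theorem flip3_basePt : flip3 basePt = basePt := by simp [flip3, basePt]

theorem continuous_bcls {Y : Type*} [TopologicalSpace Y] {x : Y → Space3} {z : Y → Fin d → ℝ}
    {φ : Y → ℝ → Space3} (hx : Continuous x) (h0 : ∀ y, x y ≠ 0) (hz : Continuous z)
    (hφ : Continuous fun p : Y × ℝ => φ p.1 p.2) (h1 : ∀ y, φ y 1 = basePt)
    (hφ0 : ∀ y s, 0 ≤ s → s ≤ 1 → φ y s ≠ 0) (hφx : ∀ y, φ y 0 = flip3 (x y)) :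
    Continuous fun y => bcls (x y) (z y) (φ y) := by
  refine continuous_iff_continuousAt.2 fun y => ?_
  by_cases hy : (x y).2 < 2 * ‖(x y).1‖
  · have hV : IsOpen {y | (x y).2 < 2 * ‖(x y).1‖} := isOpen_lt (by fun_prop) (by fun_prop)
    refine ContinuousAt.congr (f := fun _ => smashPt (d + 2)) continuousAt_const ?_
    filter_upwards [hV.mem_nhds hy] with y' hy'
    exact (bcls_of_lt hy' _ _).symm
  · have hV : IsOpen {y | 0 < (x y).2} := isOpen_lt (by fun_prop) (by fun_prop)
    have hy' : 0 < (x y).2 := by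
      have := norm_nonneg (x y).1
      refine lt_of_le_of_ne (by linarith) fun e => h0 y ?_
      refine Prod.ext (norm_le_zero_iff.1 (by linarith)) e.symm
    refine ContinuousOn.continuousAt ?_ (hV.mem_nhds hy')
    rw [continuousOn_iff_continuous_domRestrict]
    have hc : Continuous fun y : {y | 0 < (x y).2} => coneCoord (x y.1) :=
      (hx.coneCoord h0).comp continuous_subtype_val
    have hz' : Continuous fun y : {y | 0 < (x y).2} => z y.1 := hz.comp continuous_subtype_val
    have : Continuous fun y : {y | 0 < (x y).2} =>
        pcls (_root_.cons2 (coneCoord (x y.1)) (z y.1)) (φ y.1) := by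
      refine continuous_pcls (hc.cons2 hz') ?_ (fun y => h1 _) fun y => .inl ⟨hφ0 y, ?_⟩
      · exact hφ.comp (f := fun p : {y | 0 < (x y).2} × ℝ => (p.1.1, p.2)) (by fun_prop)
      · rw [hφx]
        have : 0 < (x y).2 := y.2
        have := norm_nonneg (x y).1
        simp only [flip3]
        linarith
    exact this.congr fun y => (if_pos y.2).symm

end Paths

section Maps

variable {d : ℕ}

/-- Cutting time of a path as a function of the first cube coordinate. -/
def cut (t : ℝ) : ℝ := clamp ((3 * t + 1) / 2)

theorem cut_nonneg (t : ℝ) : 0 ≤ cut t := clamp_nonneg _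

theorem cut_le_one (t : ℝ) : cut t ≤ 1 := clamp_le_one _

theorem cut_of_ge {t : ℝ} (h : 1 / 3 ≤ t) : cut t = 1 := clamp_of_ge (by linarith)

theorem cut_of_le {t : ℝ} (h : t ≤ -1 / 3) : cut t = 0 := clamp_of_le (by linarith)

@[fun_prop]
theorem continuous_cut : Continuous cut := by
  unfold cut
  fun_prop

/-- The segments from `(v, 0)` to the unit vertical vector and on to the start of `ψ`, followed
by `ψ`. -/
def pre (v : ℝ × ℝ) (ψ : ℝ → Space3) (s : ℝ) : Space3 :=
  (1 - clamp (4 * s - 1)) • ((1 - clamp (4 * s)) • ((v, 0) : Space3) +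
    clamp (4 * s) • (((0, 0), 1) : Space3)) + clamp (4 * s - 1) • ψ (2 * s - 1)

theorem pre_of_le (v : ℝ × ℝ) (ψ : ℝ → Space3) {s : ℝ} (h0 : 0 ≤ s) (h1 : s ≤ 1 / 4) :
    pre v ψ s = ((1 - 4 * s) • v, 4 * s) := by
  rw [pre, clamp_of_le (r := 4 * s - 1) (by linarith), clamp_of_mem (r := 4 * s) (by linarith)
    (by linarith)]
  ext <;> simp

theorem pre_of_mid (v : ℝ × ℝ) (ψ : ℝ → Space3) {s : ℝ} (h0 : 1 / 4 ≤ s) (h1 : s ≤ 1 / 2) :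
    pre v ψ s = ((4 * s - 1) • (ψ (2 * s - 1)).1, 2 - 4 * s + (4 * s - 1) * (ψ (2 * s - 1)).2) := by
  rw [pre, clamp_of_mem (r := 4 * s - 1) (by linarith) (by linarith),
    clamp_of_ge (r := 4 * s) (by linarith)]
  ext
  · simp
  · simp
  · simp
    ring

theorem pre_of_ge (v : ℝ × ℝ) (ψ : ℝ → Space3) {s : ℝ} (h : 1 / 2 ≤ s) :
    pre v ψ s = ψ (2 * s - 1) := by
  rw [pre, clamp_of_ge (r := 4 * s - 1) (by linarith)]
  simp

theorem pre_zero (v : ℝ × ℝ) (ψ : ℝ → Space3) : pre v ψ 0 = (v, 0) := by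
  rw [pre_of_le v ψ le_rfl (by norm_num)]
  simp

theorem pre_one (v : ℝ × ℝ) (ψ : ℝ → Space3) : pre v ψ 1 = ψ 1 := by
  rw [pre_of_ge v ψ (by norm_num)]
  norm_num

theorem pre_congr (v : ℝ × ℝ) {ψ ψ' : ℝ → Space3} (h : ∀ s ≤ 1, ψ s = ψ' s) {s : ℝ} (hs : s ≤ 1) :
    pre v ψ s = pre v ψ' s := by
  rw [pre, pre, h _ (by linarith)]

/-- The reflected path with the standard initial segment. -/
def tent (v : ℝ × ℝ) (ε : PathSp) (s : ℝ) : Space3 := pre v (fun r => flip3 (ev ε r)) s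

@[fun_prop]
theorem Continuous.tent {Y : Type*} [TopologicalSpace Y] {v : Y → ℝ × ℝ} {ε : Y → PathSp}
    {s : Y → ℝ} (hv : Continuous v) (hε : Continuous ε) (hs : Continuous s) :
    Continuous fun y => tent (v y) (ε y) (s y) := by
  unfold _root_.tent pre
  fun_prop

theorem tent_zero (v : ℝ × ℝ) (ε : PathSp) : tent v ε 0 = (v, 0) := pre_zero v _

theorem tent_one (v : ℝ × ℝ) (ε : PathSp) : tent v ε 1 = basePt := by
  rw [tent, pre_one, ev_of_ge ε le_rfl, flip3_basePt]

theorem tent_of_ge (v : ℝ × ℝ) (ε : PathSp) {s : ℝ} (h : 1 / 2 ≤ s) :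
    tent v ε s = flip3 (ev ε (2 * s - 1)) := pre_of_ge v _ h

theorem tent_of_le (v : ℝ × ℝ) (ε : PathSp) {s : ℝ} (h0 : 0 ≤ s) (h1 : s ≤ 1 / 4) :
    tent v ε s = ((1 - 4 * s) • v, 4 * s) := pre_of_le v _ h0 h1

theorem tent_of_mid (v : ℝ × ℝ) (ε : PathSp) {s : ℝ} (h0 : 1 / 4 ≤ s) (h1 : s ≤ 1 / 2) :
    tent v ε s = ((4 * s - 1) • (ev ε 0).1, 2 - 4 * s - (4 * s - 1) * (ev ε 0).2) := by
  rw [tent, pre_of_mid v _ h0 h1, ev_of_le ε (by linarith)]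
  ext <;> simp [flip3]
  ring

/-- In the first half, the reflected path stays outside of the lower cone. -/
theorem tent_lt (v : ℝ × ℝ) (ε : PathSp) {s : ℝ} (h0 : 0 ≤ s) (h1 : s ≤ 1 / 2)
    (h : v ≠ 0 ∨ 0 < s) : -(tent v ε s).2 < 2 * ‖(tent v ε s).1‖ := by
  rcases le_total s (1 / 4) with h2 | h2
  · rw [tent_of_le v ε h0 h2]
    have h3 := norm_nonneg ((1 - 4 * s) • v)
    rcases h0.eq_or_lt with rfl | h4
    · have : 0 < ‖v‖ := norm_pos_iff.2 (by simpa using h)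
      simpa using this
    · dsimp only
      linarith
  · rw [tent_of_mid v ε h2 h1]
    dsimp only
    rw [norm_smul, Real.norm_of_nonneg (by linarith)]
    rcases h2.eq_or_lt with h3 | h3
    · rw [← h3]
      norm_num
    · have := ev_zero_lt ε
      nlinarith

theorem tent_ne (v : ℝ × ℝ) (ε : PathSp) {s : ℝ} (h0 : 0 ≤ s)
    (h : v ≠ 0 ∨ 0 < s) : tent v ε s ≠ 0 := by
  rcases le_total s (1 / 2) with h2 | h2
  · intro h3
    have := tent_lt v ε h0 h2 h
    rw [h3] at this
    simp at this
  · rw [tent_of_ge v ε h2]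
    exact flip3_ne (ev_ne _ _)

theorem good_tent {v : ℝ × ℝ} (hv : v ≠ 0) (ε : PathSp) : Good (tent v ε) where
  cont := Continuous.continuousOn (by fun_prop)
  ne _ h0 _ := tent_ne v ε h0 (.inl hv)
  one := tent_one v ε
  zero := by simpa [tent_zero] using hv

/-- The first two coordinates. -/
def head2 (z : Fin (d + 2) → ℝ) : ℝ × ℝ := (z 0, Fin.tail z 0)

/-- All but the first two coordinates. -/
def tail2 (z : Fin (d + 2) → ℝ) : Fin d → ℝ := Fin.tail (Fin.tail z)

@[fun_prop]
theorem continuous_head2 : Continuous (head2 (d := d)) := by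
  unfold head2 Fin.tail
  fun_prop

@[fun_prop]
theorem continuous_tail2 : Continuous (tail2 (d := d)) := by
  unfold tail2
  fun_prop

theorem cons2_head2 (z : Fin (d + 2) → ℝ) : cons2 (head2 z) (tail2 z) = z := by
  rw [cons2, head2, tail2, Fin.cons_self_tail, Fin.cons_self_tail]

theorem outside_iff_tail {z : Fin (d + 1) → ℝ} :
    Outside z ↔ 1 ≤ |z 0| ∨ Outside (Fin.tail z) := by
  conv_lhs => rw [← Fin.cons_self_tail z]
  exact outside_cons

theorem outside_iff_tail2 {z : Fin (d + 2) → ℝ} :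
    Outside z ↔ 1 ≤ ‖head2 z‖ ∨ Outside (tail2 z) := by
  conv_lhs => rw [← cons2_head2 z]
  exact outside_cons2

theorem sout_cons {t : ℝ} (h : 1 < t) (z : Fin d → ℝ) :
    ∃ i, 1 < |(Fin.cons t z : Fin (d + 1) → ℝ) i| :=
  ⟨0, lt_of_lt_of_le h (le_abs_self _)⟩

theorem one_le_abs_of_ge {t : ℝ} (h : 1 ≤ t) : 1 ≤ |t| := h.trans (le_abs_self t)

theorem one_le_abs_of_le {t : ℝ} (h : t ≤ -1) : 1 ≤ |t| := le_abs'.2 (.inl h)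

/-- Inclusion of the sphere at the constant path. -/
def inc (s : SphereSp d) : PathSmash d := Quot.mk _ (s, constPath)

theorem continuous_inc : Continuous (inc (d := d)) :=
  continuous_quot_mk.comp (by fun_prop)

theorem inc_cubeMap (z : Fin d → ℝ) : inc (cubeMap z) = cls (z, constPath) := rfl

/-- Projection to the sphere, supported where no part of the path is left after cutting. -/
def proj : PathSmash (d + 1) → SphereSp (d + 1) :=
  (collapse_cls d).desc fun p => cubeMap (Fin.cons (3 * p.1 0 - 2) (Fin.tail p.1))

theorem proj_aux (p : (Fin (d + 1) → ℝ) × PathSp) (hp : Outside p.1) :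
    cubeMap (Fin.cons (3 * p.1 0 - 2) (Fin.tail p.1) : Fin (d + 1) → ℝ) = spherePt (d + 1) := by
  rw [cubeMap_eq_base, outside_cons]
  refine (outside_iff_tail.1 hp).imp (fun h => ?_) id
  rcases le_abs'.1 h with h | h
  · exact one_le_abs_of_le (by linarith)
  · exact one_le_abs_of_ge (by linarith)

theorem continuous_proj : Continuous (proj (d := d)) :=
  (collapse_cls d).continuous_desc proj_aux (continuous_cubeMap.comp (by fun_prop))

theorem proj_cls (z : Fin (d + 1) → ℝ) (γ : PathSp) :
    proj (cls (z, γ)) = cubeMap (Fin.cons (3 * z 0 - 2) (Fin.tail z)) :=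
  (collapse_cls d).desc_apply proj_aux _

theorem proj_base : proj (smashPt (d + 1)) = spherePt (d + 1) :=
  (collapse_cls d).desc_base proj_aux

theorem proj_pcls {t : ℝ} {z : Fin d → ℝ} {φ : ℝ → Space3}
    (h : Good φ ∨ Outside (Fin.cons t z : Fin (d + 1) → ℝ)) :
    proj (pcls (Fin.cons t z) φ) = cubeMap (Fin.cons (3 * t - 2) z) := by
  rcases h with h | h
  · rw [h.pcls_eq, proj_cls]
    simp
  · rw [pcls_outside h, proj_base]
    exact (proj_aux (Fin.cons t z, constPath) h).symm

/-- The remaining path after cutting, with the radial coordinate of its start recorded. -/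
def rest : PathSmash (d + 1) → PathSmash (d + 2) :=
  (collapse_cls d).desc fun p => bcls (ev p.2 (cut (p.1 0))) (Fin.tail p.1)
    fun s => flip3 (ev p.2 (max (cut (p.1 0)) s))

theorem rest_aux (p : (Fin (d + 1) → ℝ) × PathSp) (hp : Outside p.1) :
    bcls (ev p.2 (cut (p.1 0))) (Fin.tail p.1) (fun s => flip3 (ev p.2 (max (cut (p.1 0)) s))) =
      smashPt (d + 2) := by
  rcases outside_iff_tail.1 hp with h | h
  · rcases le_abs'.1 h with h | h
    · rw [cut_of_le (by linarith)]
      exact bcls_of_lt (ev_zero_lt _) _ _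
    · rw [cut_of_ge (by linarith), ev_of_ge _ le_rfl]
      exact bcls_of_nonpos le_rfl _ _
  · exact bcls_outside h _ _

theorem continuous_rest : Continuous (rest (d := d)) := by
  refine (collapse_cls d).continuous_desc rest_aux ?_
  refine continuous_bcls (by fun_prop) (fun p => ev_ne _ _) (by fun_prop) (by fun_prop)
    (fun p => ?_) (fun p s _ _ => flip3_ne (ev_ne _ _)) fun p => ?_
  · rw [max_eq_right (cut_le_one _), ev_of_ge _ le_rfl, flip3_basePt]
  · rw [max_eq_left (cut_nonneg _)]

theorem rest_cls (z : Fin (d + 1) → ℝ) (γ : PathSp) :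
    rest (cls (z, γ)) = bcls (ev γ (cut (z 0))) (Fin.tail z)
      fun s => flip3 (ev γ (max (cut (z 0)) s)) :=
  (collapse_cls d).desc_apply rest_aux _

theorem rest_base : rest (smashPt (d + 1)) = smashPt (d + 2) :=
  (collapse_cls d).desc_base rest_aux

theorem rest_pcls {t : ℝ} {z : Fin d → ℝ} {φ : ℝ → Space3} (h1 : φ 1 = basePt)
    (h : Good φ ∨ 1 ≤ t ∨ Outside z) :
    rest (pcls (Fin.cons t z) φ) = bcls (φ (cut t)) z fun s => flip3 (φ (max (cut t) s)) := by
  rcases h with h | h | h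
  · rw [h.pcls_eq, rest_cls]
    simp only [Fin.cons_zero, Fin.tail_cons, h.ev_path]
    rw [clamp_of_mem (cut_nonneg t) (cut_le_one t)]
    refine bcls_congr _ _ fun s h0 h1 => ?_
    rw [clamp_of_mem (le_max_of_le_right h0) (max_le (cut_le_one t) h1)]
  · rw [pcls_outside (outside_cons.2 (.inl (one_le_abs_of_ge h))), rest_base,
      cut_of_ge (by linarith), h1]
    exact (bcls_of_nonpos le_rfl _ _).symm
  · rw [pcls_outside (outside_cons.2 (.inr h)), rest_base, bcls_outside h]

/-- Put the standard initial segment in front of a path. -/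
def extend : PathSmash (d + 2) → PathSmash (d + 1) :=
  (collapse_cls (d + 1)).desc fun p =>
    pcls (Fin.cons (2 - 3 * ‖head2 p.1‖) (tail2 p.1)) (tent (head2 p.1) p.2)

theorem extend_aux (p : (Fin (d + 2) → ℝ) × PathSp) (hp : Outside p.1) :
    pcls (Fin.cons (2 - 3 * ‖head2 p.1‖) (tail2 p.1)) (tent (head2 p.1) p.2) =
      smashPt (d + 1) := by
  refine pcls_outside (outside_cons.2 ((outside_iff_tail2.1 hp).imp (fun h => ?_) id)) _
  exact one_le_abs_of_le (by linarith)

theorem continuous_extend : Continuous (extend (d := d)) := by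
  refine (collapse_cls (d + 1)).continuous_desc extend_aux ?_
  refine continuous_pcls (by fun_prop) (by fun_prop) (fun p => tent_one _ _) fun p => ?_
  by_cases h : head2 p.1 = 0
  · rw [h, norm_zero]
    exact .inr (sout_cons (by norm_num) _)
  · have := good_tent h p.2
    exact .inl ⟨this.ne, this.zero⟩

theorem extend_cls (z : Fin (d + 2) → ℝ) (γ : PathSp) :
    extend (cls (z, γ)) = pcls (Fin.cons (2 - 3 * ‖head2 z‖) (tail2 z)) (tent (head2 z) γ) :=
  (collapse_cls (d + 1)).desc_apply extend_aux _

theorem extend_base : extend (smashPt (d + 2)) = smashPt (d + 1) :=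
  (collapse_cls (d + 1)).desc_base extend_aux

theorem extend_pcls {v : ℝ × ℝ} {z : Fin d → ℝ} {φ : ℝ → Space3} (h : Good φ) :
    extend (pcls (cons2 v z) φ) =
      pcls (Fin.cons (2 - 3 * ‖v‖) z) (pre v fun s => flip3 (φ (clamp s))) := by
  rw [h.pcls_eq, extend_cls]
  rfl

theorem rest_inc (s : SphereSp (d + 1)) : rest (inc s) = smashPt (d + 2) := by
  obtain ⟨z, -, rfl⟩ := cubeMap_surj_ball d.succ_pos s
  rw [inc_cubeMap, rest_cls]
  exact bcls_of_nonpos le_rfl _ _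

theorem proj_or_rest (x : PathSmash (d + 1)) :
    proj x = spherePt (d + 1) ∨ rest x = smashPt (d + 2) := by
  obtain ⟨⟨z, γ⟩, rfl⟩ := (collapse_cls d).quot.surjective x
  rw [proj_cls, rest_cls, cubeMap_eq_base, outside_cons]
  rcases le_total (1 / 3) (z 0) with h | h
  · right
    rw [cut_of_ge h, ev_of_ge _ le_rfl]
    exact bcls_of_nonpos le_rfl _ _
  · exact .inl (.inl (one_le_abs_of_le (by linarith)))

theorem proj_inc : PHtpy (spherePt (d + 1)) (proj ∘ inc) id := by
  refine (isCollapse_cubeMap d.succ_pos).phtpy (F := fun p =>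
    cubeMap (Fin.cons ((1 - (p.1 : ℝ)) * (3 * p.2 0 - 2) + p.1 * p.2 0) (Fin.tail p.2)))
    (y₀ := spherePt (d + 1)) (fun s x hx => ?_) (continuous_cubeMap.comp (by fun_prop))
    (fun x => ?_) fun x => ?_
  · rw [cubeMap_eq_base, outside_cons]
    refine (outside_iff_tail.1 hx).imp (fun h => ?_) id
    have h0 := s.2.1
    have h1 := s.2.2
    rcases le_abs'.1 h with h | h
    · exact one_le_abs_of_le (by nlinarith)
    · exact one_le_abs_of_ge (by nlinarith)
  · rw [Function.comp, inc_cubeMap, proj_cls]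
    simp
  · simp

end Maps

section Decomposition

theorem IsCollapse.phtpy₂ {X A Y : Type*} [TopologicalSpace X] [TopologicalSpace A]
    [TopologicalSpace Y] {q : X → A} {O : X → Prop} {a₀ : A} (h : IsCollapse q O a₀)
    {F G : I × X → Y} {y₀ : Y} (hF : ∀ s x, O x → F (s, x) = y₀) (cF : Continuous F)
    (hG : ∀ s x, O x → G (s, x) = y₀) (cG : Continuous G) (hFG : ∀ x, F (1, x) = G (0, x))
    {f g : A → Y} (hf : ∀ x, F (0, x) = f (q x)) (hg : ∀ x, G (1, x) = g (q x)) :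
    PHtpy a₀ f g := by
  have key : ∀ x, F (1, x) = h.desc (fun x => F (1, x)) (q x) :=
    fun x => (h.desc_apply (hF 1) x).symm
  exact (h.phtpy hF cF hf key).trans (h.phtpy hG cG (fun x => (hFG x).symm.trans (key x)) hg)

theorem IsCollapse.phtpy₃ {X A Y : Type*} [TopologicalSpace X] [TopologicalSpace A]
    [TopologicalSpace Y] {q : X → A} {O : X → Prop} {a₀ : A} (h : IsCollapse q O a₀)
    {F G K : I × X → Y} {y₀ : Y} (hF : ∀ s x, O x → F (s, x) = y₀) (cF : Continuous F)
    (hG : ∀ s x, O x → G (s, x) = y₀) (cG : Continuous G) (hK : ∀ s x, O x → K (s, x) = y₀)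
    (cK : Continuous K) (hFG : ∀ x, F (1, x) = G (0, x)) (hGK : ∀ x, G (1, x) = K (0, x))
    {f g : A → Y} (hf : ∀ x, F (0, x) = f (q x)) (hg : ∀ x, K (1, x) = g (q x)) :
    PHtpy a₀ f g := by
  have key : ∀ x, F (1, x) = h.desc (fun x => F (1, x)) (q x) :=
    fun x => (h.desc_apply (hF 1) x).symm
  exact (h.phtpy hF cF hf key).trans
    (h.phtpy₂ hG cG hK cK hGK (fun x => (hFG x).symm.trans (key x)) hg)

variable {d : ℕ}

/-- A function that is `-1` outside of the upper cone and parametrises its radius. -/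
def coneLevel (x : Space3) : ℝ := max (-1) ((2 * x.2 - 6 * ‖x.1‖) / ‖x‖)

/-- A function that is one on the upper cone. -/
def coneBump (x : Space3) : ℝ := clamp (2 * x.2 / ‖x‖ - 1)

theorem Continuous.coneLevel {Y : Type*} [TopologicalSpace Y] {x : Y → Space3}
    (hx : Continuous x) (h : ∀ y, x y ≠ 0) : Continuous fun y => coneLevel (x y) := by
  have : Continuous fun y => (2 * (x y).2 - 6 * ‖(x y).1‖) / ‖x y‖ :=
    Continuous.div (by fun_prop) (by fun_prop) fun y => norm_ne_zero_iff.2 (h y)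
  exact continuous_const.max this

theorem Continuous.coneBump {Y : Type*} [TopologicalSpace Y] {x : Y → Space3}
    (hx : Continuous x) (h : ∀ y, x y ≠ 0) : Continuous fun y => coneBump (x y) := by
  have : Continuous fun y => 2 * (x y).2 / ‖x y‖ - 1 :=
    (Continuous.div (by fun_prop) (by fun_prop) fun y => norm_ne_zero_iff.2 (h y)).sub
      continuous_const
  exact continuous_clamp.comp this

theorem neg_one_le_coneLevel (x : Space3) : -1 ≤ coneLevel x := le_max_left _ _

theorem coneLevel_of_le {x : Space3} (h0 : x ≠ 0) (h : x.2 ≤ 2 * ‖x.1‖) : coneLevel x = -1 := by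
  refine max_eq_left ?_
  rw [div_le_iff₀ (norm_pos_iff.2 h0), norm_space3]
  have := norm_nonneg x.1
  rcases max_cases ‖x.1‖ |x.2| with h1 | h1 <;> rcases abs_cases x.2 with h2 | h2 <;> linarith

theorem norm_of_ge {x : Space3} (h : 2 * ‖x.1‖ ≤ x.2) : ‖x‖ = x.2 := by
  have := norm_nonneg x.1
  rw [norm_space3, abs_of_nonneg (by linarith), max_eq_right (by linarith)]

theorem coneLevel_of_ge {x : Space3} (h0 : 0 < x.2) (h : 2 * ‖x.1‖ ≤ x.2) :
    coneLevel x = 2 - 3 * ‖coneCoord x‖ := by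
  rw [norm_coneCoord, coneLevel, norm_of_ge h, max_eq_right]
  · field_simp
    ring
  · rw [le_div_iff₀ h0]
    linarith

theorem coneBump_of_ge {x : Space3} (h0 : 0 < x.2) (h : 2 * ‖x.1‖ ≤ x.2) : coneBump x = 1 := by
  rw [coneBump, norm_of_ge h]
  refine clamp_of_ge ?_
  rw [mul_div_assoc, div_self h0.ne']
  norm_num

theorem coneBump_of_nonpos {x : Space3} (h : x.2 ≤ 0) : coneBump x = 0 := by
  refine clamp_of_le ?_
  have : 2 * x.2 / ‖x‖ ≤ 0 := div_nonpos_of_nonpos_of_nonneg (by linarith) (norm_nonneg _)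
  linarith

theorem space3_ne {x : Space3} (h : x.1 ≠ 0 ∨ x.2 ≠ 0) : x ≠ 0 := by
  rintro rfl
  simp at h

/-- The path from time `τ` on, with an initial segment that starts at nonpositive height. -/
def low (γ : PathSp) (τ s : ℝ) : Space3 :=
  ((ev γ (max τ (2 * s - 1))).1,
    (ev γ (max τ (2 * s - 1))).2 - (1 - clamp (2 * s)) * max 0 (ev γ τ).2)

/-- Interpolation between two initial segments for the path from time `τ` on. -/
def mix (c : ℝ) (γ : PathSp) (τ s : ℝ) : Space3 :=
  (1 - c) • low γ τ s + c • pre (coneCoord (ev γ τ)) (fun r => ev γ (max τ r)) s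

@[fun_prop]
theorem Continuous.mix {Y : Type*} [TopologicalSpace Y] {c : Y → ℝ} {γ : Y → PathSp}
    {τ s : Y → ℝ} (hc : Continuous c) (hγ : Continuous γ) (hτ : Continuous τ)
    (hs : Continuous s) : Continuous fun y => mix (c y) (γ y) (τ y) (s y) := by
  have : Continuous fun y => _root_.coneCoord (_root_.ev (γ y) (τ y)) :=
    Continuous.coneCoord (x := fun y => _root_.ev (γ y) (τ y)) (_root_.Continuous.ev hγ hτ)
      fun y => ev_ne _ _
  unfold _root_.mix low pre
  fun_prop

theorem low_of_le (γ : PathSp) {τ s : ℝ} (h0 : 0 ≤ s) (h1 : s ≤ 1 / 2) (hτ : 0 ≤ τ) :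
    low γ τ s = ((ev γ τ).1, (ev γ τ).2 - (1 - 2 * s) * max 0 (ev γ τ).2) := by
  rw [low, max_eq_left (by linarith), clamp_of_mem (by linarith) (by linarith)]

theorem low_of_ge (γ : PathSp) {τ s : ℝ} (h : 1 / 2 ≤ s) :
    low γ τ s = ev γ (max τ (2 * s - 1)) := by
  rw [low, clamp_of_ge (by linarith)]
  simp

theorem mix_zero (γ : PathSp) (τ : ℝ) : mix 0 γ τ = low γ τ := by
  ext s <;> simp [mix]

theorem mix_of_ge (c : ℝ) (γ : PathSp) {τ s : ℝ} (h : 1 / 2 ≤ s) :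
    mix c γ τ s = ev γ (max τ (2 * s - 1)) := by
  rw [mix, low_of_ge γ h, pre_of_ge _ _ h, ← add_smul]
  simp

theorem mix_one (c : ℝ) (γ : PathSp) (τ : ℝ) : mix c γ τ 1 = basePt := by
  rw [mix_of_ge c γ (by norm_num), ev_of_ge]
  norm_num

theorem good_mix {c : ℝ} {γ : PathSp} {τ : ℝ} (c0 : 0 ≤ c) (c1 : c ≤ 1) (h0 : 0 ≤ τ)
    (h : (ev γ τ).1 ≠ 0 ∨ (ev γ τ).2 < 0) (hc : (ev γ τ).2 < 0 → c = 0) : Good (mix c γ τ) := by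
  have start : ∀ s, 0 ≤ s → s ≤ 1 / 2 → (ev γ τ).1 ≠ 0 → mix c γ τ s ≠ 0 := by
    intro s s0 s1 hy
    have hm : 0 < ‖ev γ τ‖ := norm_pos_iff.2 (ev_ne _ _)
    intro e
    have e1 := congrArg Prod.fst e
    have e2 := congrArg Prod.snd e
    rw [mix, low_of_le γ s0 s1 h0, pre, max_eq_left (show 2 * s - 1 ≤ τ by linarith)] at e1 e2
    simp only [Prod.fst_add, Prod.smul_fst, coneCoord, Prod.fst_zero, Prod.snd_add, Prod.smul_snd,
      Prod.snd_zero, smul_eq_mul, mul_zero, mul_one, zero_add] at e1 e2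
    have hz : ((0 : ℝ), (0 : ℝ)) = 0 := rfl
    rw [hz, smul_zero, add_zero, smul_smul, smul_smul, ← add_smul, smul_smul, ← add_smul,
      smul_eq_zero, or_iff_left hy] at e1
    have a0 := clamp_nonneg (4 * s)
    have a1 := clamp_le_one (4 * s)
    have b0 := clamp_nonneg (4 * s - 1)
    have b1 := clamp_le_one (4 * s - 1)
    have hp : 0 < 2 / ‖ev γ τ‖ := by positivity
    have n1 : 0 ≤ (1 - clamp (4 * s - 1)) * ((1 - clamp (4 * s)) * (2 / ‖ev γ τ‖)) :=
      mul_nonneg (by linarith) (mul_nonneg (by linarith) hp.le)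
    have hc1 : c = 1 := by nlinarith
    subst hc1
    have hb : clamp (4 * s - 1) = 0 := by nlinarith
    rw [hb] at e1 e2
    have ha : clamp (4 * s) = 1 := by
      by_contra hne
      have : 0 < (1 - clamp (4 * s)) * (2 / ‖ev γ τ‖) :=
        mul_pos (sub_pos.2 (lt_of_le_of_ne a1 hne)) hp
      simp only [sub_self, sub_zero, one_mul, add_zero, zero_add] at e1
      linarith
    rw [ha] at e2
    norm_num at e2
  refine ⟨Continuous.continuousOn (by fun_prop), fun s s0 s1 => ?_, mix_one c γ _, ?_⟩
  · rcases le_total s (1 / 2) with hs | hs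
    · by_cases hy : (ev γ τ).1 = 0
      · have hn := h.resolve_left (not_not.2 hy)
        rw [hc hn, mix_zero, low_of_le γ s0 hs h0, max_eq_left hn.le]
        exact space3_ne (.inr (by simpa using hn.ne))
      · exact start s s0 hs hy
    · rw [mix_of_ge c γ hs]
      exact ev_ne _ _
  · have e : (mix c γ τ 0).2 = (1 - c) * ((ev γ τ).2 - max 0 (ev γ τ).2) := by
      rw [mix, pre_zero, low_of_le γ le_rfl (by norm_num) h0]
      simp
    have hle := le_max_right 0 (ev γ τ).2
    by_cases hy : (ev γ τ).1 = 0
    · have hn := h.resolve_left (not_not.2 hy)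
      rw [e, hc hn, max_eq_left hn.le]
      have := norm_nonneg (mix 0 γ τ 0).1
      linarith
    · have : 0 < ‖(mix c γ τ 0).1‖ := by
        have := start 0 le_rfl (by norm_num) hy
        rw [norm_pos_iff]
        intro h3
        have h4 : (mix c γ τ 0).1 = (1 - c) • (ev γ τ).1 + c • (2 / ‖ev γ τ‖) • (ev γ τ).1 := by
          rw [mix, pre_zero, low_of_le γ le_rfl (by norm_num) h0]
          rfl
        rw [h4, smul_smul, ← add_smul, smul_eq_zero, or_iff_left hy] at h3
        have hp : 0 < 2 / ‖ev γ τ‖ := div_pos two_pos (norm_pos_iff.2 (ev_ne _ _))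
        nlinarith [mul_nonneg c0 hp.le]
      rw [e]
      nlinarith

theorem good_mix_or_lt {c : ℝ} {γ : PathSp} {τ : ℝ} (c0 : 0 ≤ c) (c1 : c ≤ coneBump (ev γ τ))
    (h0 : 0 ≤ τ) : Good (mix c γ τ) ∨ 1 < coneLevel (ev γ τ) := by
  by_cases h : (ev γ τ).1 ≠ 0 ∨ (ev γ τ).2 < 0
  · exact .inl (good_mix c0 (c1.trans (clamp_le_one _)) h0 h fun hn =>
      le_antisymm (c1.trans (coneBump_of_nonpos hn.le).le) c0)
  · right
    push Not at h
    have h2 : 0 < (ev γ τ).2 := lt_of_le_of_ne h.2 fun e => ev_ne γ τ (Prod.ext h.1 e.symm)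
    rw [coneLevel_of_ge h2 (by simp [h.1, h.2]), norm_coneCoord, h.1]
    norm_num

theorem coneLevel_outside {t : ℝ} (h : t ≤ -1 / 3) (γ : PathSp) :
    coneLevel (ev γ (cut t)) = -1 := by
  rw [cut_of_le h]
  exact coneLevel_of_le (ev_ne _ _) (ev_zero_lt γ).le

theorem extend_rest_cls (z : Fin (d + 1) → ℝ) (γ : PathSp)
    (h0 : 0 < (ev γ (cut (z 0))).2) :
    extend (rest (cls (z, γ))) = pcls (Fin.cons (2 - 3 * ‖coneCoord (ev γ (cut (z 0)))‖)
      (Fin.tail z)) (mix 1 γ (cut (z 0))) := by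
  rw [rest_cls, bcls, if_pos h0, extend_pcls]
  · refine pcls_congr _ fun s s0 s1 => ?_
    simp only [mix, sub_self, zero_smul, one_smul, zero_add, flip3_flip3]
    refine pre_congr _ (fun r hr => ?_) s1
    rcases le_total 0 r with h | h
    · rw [clamp_of_mem h hr]
    · rw [clamp_of_le h, max_eq_left (cut_nonneg _), max_eq_left (h.trans (cut_nonneg _))]
  · refine ⟨Continuous.continuousOn (by fun_prop), fun s _ _ => flip3_ne (ev_ne _ _), ?_, ?_⟩
    · rw [max_eq_right (cut_le_one _), ev_of_ge _ le_rfl, flip3_basePt]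
    · rw [max_eq_left (cut_nonneg _)]
      have := norm_nonneg (ev γ (cut (z 0))).1
      simp only [flip3]
      linarith

open Classical in
theorem proj_rest_cls (z : Fin (d + 1) → ℝ) (γ : PathSp) :
    (if proj (cls (z, γ)) = spherePt (d + 1) then extend (rest (cls (z, γ)))
      else inc (proj (cls (z, γ)))) =
    pcls (Fin.cons (max (coneLevel (ev γ (cut (z 0)))) (3 * z 0 - 2)) (Fin.tail z))
      (mix (coneBump (ev γ (cut (z 0)))) γ (cut (z 0))) := by
  split_ifs with h
  · rw [proj_cls, cubeMap_eq_base, outside_cons] at h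
    by_cases h1 : 1 ≤ z 0 ∨ Outside (Fin.tail z)
    · rw [rest_cls, rest_aux (z, γ) (outside_iff_tail.2 (h1.imp one_le_abs_of_ge id)), extend_base]
      refine (pcls_outside (outside_cons.2 (h1.imp (fun h => ?_) id)) _).symm
      exact one_le_abs_of_ge (le_max_of_le_right (by linarith))
    · push Not at h1
      have h2 : 3 * z 0 - 2 ≤ -1 := by
        rcases le_abs'.1 (h.resolve_right h1.2) with h | h <;> linarith
      rw [max_eq_left (h2.trans (neg_one_le_coneLevel _))]
      rcases lt_or_ge (ev γ (cut (z 0))).2 (2 * ‖(ev γ (cut (z 0))).1‖) with h3 | h3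
      · rw [rest_cls, bcls_of_lt h3, extend_base, coneLevel_of_le (ev_ne _ _) h3.le, pcls_outside]
        exact outside_cons.2 (.inl (by simp))
      · have h4 : 0 < (ev γ (cut (z 0))).2 := by
          refine lt_of_le_of_ne ((by positivity : (0 : ℝ) ≤ _).trans h3) fun e => ?_
          rw [← e] at h3
          refine ev_ne γ (cut (z 0)) (Prod.ext (norm_le_zero_iff.1 (by linarith)) e.symm)
        rw [extend_rest_cls z γ h4, coneLevel_of_ge h4 h3, coneBump_of_ge h4 h3]
  · rw [proj_cls, cubeMap_eq_base, outside_cons, not_or] at h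
    have h1 : 1 / 3 ≤ z 0 := by
      by_contra! h1
      exact h.1 (one_le_abs_of_le (by linarith))
    rw [cut_of_ge h1, ev_of_ge _ le_rfl, coneLevel_of_le (by simp [basePt])
      (by simp [basePt]), coneBump_of_nonpos le_rfl, mix_zero, max_eq_right (by linarith),
      proj_cls, inc_cubeMap, ← pcls_ev]
    refine pcls_congr _ fun s s0 s1 => ?_
    rw [ev_constPath, low, max_eq_left (by linarith), ev_of_ge _ le_rfl]
    simp [basePt]

/-- The path with an initial segment of varying length that starts at nonpositive height. -/
def dip (ν : ℝ) (γ : PathSp) (s : ℝ) : Space3 :=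
  ((ev γ ((2 - ν) * s - (1 - ν))).1,
    (ev γ ((2 - ν) * s - (1 - ν))).2 - max 0 (1 - ν - 2 * s) * max 0 (ev γ 0).2)

theorem good_dip {ν : ℝ} (h0 : 0 ≤ ν) (h1 : ν ≤ 1) (γ : PathSp) : Good (dip ν γ) where
  cont := Continuous.continuousOn (by unfold dip; fun_prop)
  ne s s0 s1 := by
    rcases le_total (1 - ν) (2 * s) with h | h
    · rw [dip, max_eq_left (by linarith)]
      simpa using ev_ne _ _
    · rw [dip, ev_of_le _ (by nlinarith)]
      by_cases hy : (ev γ 0).1 = 0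
      · have h2 := ev_zero_lt γ
        rw [hy] at h2
        norm_num at h2
        rw [max_eq_left h2.le]
        exact space3_ne (.inr (by simpa using h2.ne))
      · exact space3_ne (.inl hy)
  one := by
    rw [dip, ev_of_ge γ (by linarith), max_eq_left (by linarith)]
    simp [basePt]
  zero := by
    have h2 := ev_zero_lt γ
    rw [dip, ev_of_le γ (by linarith)]
    have : 0 ≤ max 0 (1 - ν - 2 * 0) * max 0 (ev γ 0).2 := by positivity
    dsimp only
    linarith

open Classical in
theorem smash_decomposition : PHtpy (smashPt (d + 1))
    (fun x => if proj x = spherePt (d + 1) then extend (rest x) else inc (proj x)) id := by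
  have hx : Continuous fun p : I × ((Fin (d + 1) → ℝ) × PathSp) => ev p.2.2 (cut (p.2.1 0)) := by
    fun_prop
  have hl := hx.coneLevel fun p => ev_ne _ _
  have hb := hx.coneBump fun p => ev_ne _ _
  have b0 : ∀ x, 0 ≤ coneBump x := fun x => clamp_nonneg _
  have out : ∀ z : Fin (d + 1) → ℝ, Outside z → ∀ γ, Outside (Fin.tail z) ∨ 1 ≤ z 0 ∨
      (z 0 ≤ -1 ∧ coneLevel (ev γ (cut (z 0))) = -1) := fun z hz γ => by
    rcases outside_iff_tail.1 hz with h | h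
    · rcases le_abs'.1 h with h | h
      · exact .inr (.inr ⟨h, coneLevel_outside (by linarith) γ⟩)
      · exact .inr (.inl h)
    · exact .inl h
  refine (collapse_cls d).phtpy₃ (y₀ := smashPt (d + 1))
    (F := fun p => pcls (Fin.cons (max (coneLevel (ev p.2.2 (cut (p.2.1 0)))) (3 * p.2.1 0 - 2))
      (Fin.tail p.2.1)) (mix (coneBump (ev p.2.2 (cut (p.2.1 0))) * (1 - (p.1 : ℝ))) p.2.2
        (cut (p.2.1 0))))
    (G := fun p => pcls (Fin.cons (max (max (coneLevel (ev p.2.2 (cut (p.2.1 0))))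
      (3 * p.2.1 0 - 2)) (-1 + p.1 * min (3 * p.2.1 0 + 3) 2))
      (Fin.tail p.2.1)) (mix 0 p.2.2 (cut (p.2.1 0))))
    (K := fun p => pcls (Fin.cons ((1 - (p.1 : ℝ)) * (3 * p.2.1 0 + 2) + p.1 * p.2.1 0)
      (Fin.tail p.2.1)) (dip p.1 p.2.2)) ?_ ?_ ?_ ?_ ?_ ?_ ?_ ?_ ?_ ?_
  · rintro s ⟨z, γ⟩ hz
    refine pcls_outside (outside_cons.2 ?_) _
    rcases out z hz γ with h | h | ⟨h, h'⟩
    · exact .inr h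
    · exact .inl (one_le_abs_of_ge (le_max_of_le_right (by dsimp only; linarith)))
    · dsimp only
      rw [h', max_eq_left (by linarith)]
      simp
  · refine continuous_pcls (by fun_prop) (Continuous.mix
      ((hb.comp continuous_fst).mul (by fun_prop)) (by fun_prop) (by fun_prop) (by fun_prop))
      (fun p => mix_one _ _ _) fun p => ?_
    have s0 := p.1.2.1
    have s1 := p.1.2.2
    have := b0 (ev p.2.2 (cut (p.2.1 0)))
    rcases good_mix_or_lt (γ := p.2.2) (c := coneBump (ev p.2.2 (cut (p.2.1 0))) * (1 - (p.1 : ℝ)))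
      (τ := cut (p.2.1 0)) (mul_nonneg this (by linarith)) (by nlinarith) (cut_nonneg _)
      with h | h
    · exact .inl ⟨h.ne, h.zero⟩
    · exact .inr (sout_cons (lt_max_of_lt_left h) _)
  · rintro s ⟨z, γ⟩ hz
    refine pcls_outside (outside_cons.2 ?_) _
    have s0 := s.2.1
    rcases out z hz γ with h | h | ⟨h, h'⟩
    · exact .inr h
    · exact .inl (one_le_abs_of_ge (le_max_of_le_left (le_max_of_le_right (by
        dsimp only; linarith))))
    · dsimp only
      have : (s : ℝ) * min (3 * z 0 + 3) 2 ≤ 0 :=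
        mul_nonpos_of_nonneg_of_nonpos s0 (min_le_of_left_le (by linarith))
      rw [h', max_eq_left (a := (-1 : ℝ)) (by linarith), max_eq_left (by linarith)]
      simp
  · refine continuous_pcls (by fun_prop) (by fun_prop) (fun p => mix_one _ _ _)
      fun p => ?_
    rcases good_mix_or_lt (γ := p.2.2) (c := 0) (τ := cut (p.2.1 0)) le_rfl (b0 _) (cut_nonneg _)
      with h | h
    · exact .inl ⟨h.ne, h.zero⟩
    · exact .inr (sout_cons (lt_max_of_lt_left (lt_max_of_lt_left h)) _)
  · rintro s ⟨z, γ⟩ hz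
    refine pcls_outside (outside_cons.2 ((outside_iff_tail.1 hz).imp (fun h => ?_) id)) _
    have s0 := s.2.1
    have s1 := s.2.2
    dsimp only
    rcases le_abs'.1 h with h | h
    · exact one_le_abs_of_le (by nlinarith)
    · exact one_le_abs_of_ge (by nlinarith)
  · refine continuous_pcls (by fun_prop) ?_ (fun p => (good_dip p.1.2.1 p.1.2.2 p.2.2).one)
      fun p => .inl ?_
    · unfold dip
      fun_prop
    · have := good_dip p.1.2.1 p.1.2.2 p.2.2
      exact ⟨this.ne, this.zero⟩
  · rintro ⟨z, γ⟩
    have := neg_one_le_coneLevel (ev γ (cut (z 0)))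
    simp only [Set.Icc.coe_one, sub_self, mul_zero, Set.Icc.coe_zero, zero_mul, add_zero]
    rw [max_eq_left (le_max_of_le_left this)]
  · rintro ⟨z, γ⟩
    simp only [Set.Icc.coe_one, zero_mul, one_mul, sub_zero, Set.Icc.coe_zero, add_zero]
    rcases le_total (-1 / 3) (z 0) with h | h
    · rw [pcls_outside (outside_cons.2 (.inl (one_le_abs_of_ge (le_max_of_le_right ?_)))),
        pcls_outside (outside_cons.2 (.inl (one_le_abs_of_ge ?_)))]
      · linarith
      · rcases min_cases (3 * z 0 + 3) 2 with h | h <;> linarith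
    · rw [coneLevel_outside h, max_eq_left (a := (-1 : ℝ)) (by linarith),
        min_eq_left (by linarith)]
      rcases le_total (3 * z 0 + 2) (-1) with h1 | h1
      · rw [max_eq_left (by linarith), pcls_outside (outside_cons.2 (.inl (by simp))),
          pcls_outside (outside_cons.2 (.inl (one_le_abs_of_le h1)))]
      · rw [max_eq_right (by linarith), show -1 + (3 * z 0 + 3) = 3 * z 0 + 2 by ring]
        refine pcls_congr _ fun s s0 s1 => ?_
        have e : ev γ (max 0 (2 * s - 1)) = ev γ (2 * s - 1) := by
          rcases le_total 0 (2 * s - 1) with h | h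
          · rw [max_eq_right h]
          · rw [max_eq_left h, ev_of_le _ h]
        rw [mix_zero, low, cut_of_le h, e, dip, show (2 - 0) * s - (1 - 0) = 2 * s - 1 by ring]
        have e2 : (1 : ℝ) - clamp (2 * s) = max 0 (1 - 0 - 2 * s) := by
          rcases le_total (2 * s) 1 with h | h
          · rw [clamp_of_mem (by linarith) h, max_eq_right (by linarith)]
            ring
          · rw [clamp_of_ge h, max_eq_left (by linarith)]
            ring
        rw [e2]
  · rintro ⟨z, γ⟩
    rw [proj_rest_cls]
    simp
  · rintro ⟨z, γ⟩
    rw [id, ← pcls_ev]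
    simp only [Set.Icc.coe_one, sub_self, zero_mul, one_mul, zero_add, Fin.cons_self_tail]
    refine pcls_congr _ fun s s0 s1 => ?_
    rw [dip, max_eq_left (by linarith)]
    norm_num

end Decomposition

section Retraction

variable {d : ℕ}

/-- The first coordinate of the extended path during the deformation. -/
def level (s : ℝ) (v : ℝ × ℝ) : ℝ := min (2 - 3 * ‖v‖) (2 - 13 / 6 * s)

@[fun_prop]
theorem Continuous.level {Y : Type*} [TopologicalSpace Y] {s : Y → ℝ} {v : Y → ℝ × ℝ}
    (hs : Continuous s) (hv : Continuous v) : Continuous fun y => level (s y) (v y) := by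
  unfold _root_.level
  fun_prop

theorem level_zero (v : ℝ × ℝ) : level 0 v = 2 - 3 * ‖v‖ := by
  have := norm_nonneg v
  exact min_eq_left (by linarith)

theorem level_one_le (v : ℝ × ℝ) : level 1 v ≤ -1 / 6 := min_le_of_right_le (by norm_num)

theorem level_le {v : ℝ × ℝ} (h : 1 ≤ ‖v‖) (s : ℝ) : level s v ≤ -1 :=
  min_le_of_left_le (by linarith)

theorem ne_or_cut_pos (s : I) (v : ℝ × ℝ) {r : ℝ} (hr : cut (level s v) ≤ r) : v ≠ 0 ∨ 0 < r := by
  refine or_iff_not_imp_left.2 fun hv => lt_of_lt_of_le ?_ hr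
  have := s.2.2
  have h : -1 / 6 ≤ level s v := by
    rw [not_not.1 hv, level, norm_zero]
    exact le_min (by norm_num) (by linarith)
  exact lt_max_of_lt_right (lt_min one_pos (by linarith))

theorem cut_level_one (v : ℝ × ℝ) : cut (level 1 v) ≤ 1 / 4 := by
  have := level_one_le v
  exact max_le (by norm_num) (min_le_of_right_le (by linarith))

theorem cut_level_of_le {v : ℝ × ℝ} (h : 1 ≤ ‖v‖) (s : ℝ) : cut (level s v) = 0 :=
  cut_of_le (by linarith [level_le h s])

theorem proj_extend_cls (z : Fin (d + 2) → ℝ) (ε : PathSp) :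
    proj (extend (cls (z, ε))) = cubeMap (Fin.cons (3 * level 0 (head2 z) - 2) (tail2 z)) := by
  rw [extend_cls, level_zero]
  refine proj_pcls ?_
  by_cases h : head2 z = 0
  · rw [h, norm_zero]
    exact .inr (outside_cons.2 (.inl (by norm_num)))
  · exact .inl (good_tent h ε)

theorem rest_extend_cls (z : Fin (d + 2) → ℝ) (ε : PathSp) :
    rest (extend (cls (z, ε))) = bcls (tent (head2 z) ε (cut (level 0 (head2 z)))) (tail2 z)
      fun r => flip3 (tent (head2 z) ε (max (cut (level 0 (head2 z))) r)) := by
  rw [extend_cls, level_zero]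
  refine rest_pcls (tent_one _ _) ?_
  by_cases h : head2 z = 0
  · rw [h, norm_zero]
    exact .inr (.inl (by norm_num))
  · exact .inl (good_tent h ε)

theorem tent_deformed_ne (s : I) (v : ℝ × ℝ) (ε : PathSp) {r : ℝ} (hr : cut (level s v) ≤ r) :
    tent v ε r ≠ 0 :=
  tent_ne v ε ((cut_nonneg _).trans hr) (ne_or_cut_pos s v hr)

theorem coneCoord_tent_zero (v : ℝ × ℝ) (ε : PathSp) :
    coneCoord (tent v ε 0) = (2 / ‖v‖) • v := by
  rw [tent_zero, coneCoord, norm_space3, abs_of_nonneg le_rfl, max_eq_left (norm_nonneg _)]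

theorem deformed_extend_phtpy (B : PathSmash (d + 2) → PathSmash (d + 2))
    (hB : ∀ z ε, B (cls (z, ε)) = bcls (tent (head2 z) ε (cut (level 1 (head2 z)))) (tail2 z)
      fun r => flip3 (tent (head2 z) ε (max (cut (level 1 (head2 z))) r))) :
    PHtpy (smashPt (d + 2)) B id := by
  have lt1 : ∀ (v : ℝ × ℝ) ε r, cut (level 1 v) ≤ r → r ≤ 1 / 2 →
      -(tent v ε r).2 < 2 * ‖(tent v ε r).1‖ := fun v ε r h h' =>
    tent_lt v ε ((cut_nonneg _).trans h) h' (ne_or_cut_pos 1 v h)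
  have ne1 : ∀ (v : ℝ × ℝ) ε r, cut (level 1 v) ≤ r → tent v ε r ≠ 0 :=
    fun v ε r h => tent_deformed_ne 1 v ε h
  have hx : Continuous fun p : I × ((Fin (d + 2) → ℝ) × PathSp) =>
      tent (head2 p.2.1) p.2.2 (cut (level 1 (head2 p.2.1))) := by fun_prop
  have hκ := hx.coneCoord fun p => ne1 _ _ _ le_rfl
  have ht : ∀ z : Fin (d + 2) → ℝ, cut (level 1 (head2 z)) ≤ 1 / 4 := fun z => cut_level_one _
  refine (collapse_cls (d + 1)).phtpy₂ (y₀ := smashPt (d + 2))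
    (F := fun p => pcls
      (cons2 (coneCoord (tent (head2 p.2.1) p.2.2 (cut (level 1 (head2 p.2.1))))) (tail2 p.2.1))
      fun r => flip3 (tent (head2 p.2.1) p.2.2
        (max (max (cut (level 1 (head2 p.2.1))) (p.1 / 2)) r)))
    (G := fun p => pcls
      (cons2 ((1 - (p.1 : ℝ)) • coneCoord (tent (head2 p.2.1) p.2.2 (cut (level 1 (head2 p.2.1)))) +
        (p.1 : ℝ) • head2 p.2.1) (tail2 p.2.1))
      fun r => ev p.2.2 ((2 - (p.1 : ℝ)) * r - (1 - (p.1 : ℝ)))) ?_ ?_ ?_ ?_ ?_ ?_ ?_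
  · rintro s ⟨z, ε⟩ hz
    refine pcls_outside (outside_cons2.2 ((outside_iff_tail2.1 hz).imp (fun h => ?_) id)) _
    have hv : head2 z ≠ 0 := norm_pos_iff.1 (by linarith)
    rw [cut_level_of_le h, coneCoord_tent_zero, norm_smul, norm_div, norm_norm,
      div_mul_cancel₀ _ (norm_ne_zero_iff.2 hv)]
    norm_num
  · refine continuous_pcls (by fun_prop) (by fun_prop) (fun p => ?_)
      fun p => .inl ⟨fun r r0 r1 => flip3_ne (ne1 _ _ _ ?_), ?_⟩
    · have := p.1.2.2
      rw [max_eq_right (max_le (cut_le_one _) (by linarith)), tent_one, flip3_basePt]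
    · exact le_max_of_le_left (le_max_left _ _)
    · have := p.1.2.2
      refine lt1 _ _ _ (le_max_of_le_left (le_max_left _ _)) ?_
      exact max_le (max_le ((ht _).trans (by norm_num)) (by linarith)) (by norm_num)
  · rintro s ⟨z, ε⟩ hz
    refine pcls_outside (outside_cons2.2 ((outside_iff_tail2.1 hz).imp (fun h => ?_) id)) _
    have hv : 0 < ‖head2 z‖ := by linarith
    have s0 := s.2.1
    have s1 := s.2.2
    dsimp only
    have hp : 0 ≤ (1 - (s : ℝ)) * (2 / ‖head2 z‖) :=
      mul_nonneg (by linarith) (by positivity)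
    rw [cut_level_of_le h, coneCoord_tent_zero, smul_smul, ← add_smul,
      norm_smul, Real.norm_of_nonneg (by linarith), add_mul, mul_assoc,
      div_mul_cancel₀ _ hv.ne']
    nlinarith
  · refine continuous_pcls (by fun_prop) (by fun_prop) (fun p => ?_)
      fun p => .inl ⟨fun r r0 r1 => ev_ne _ _, ?_⟩
    · rw [ev_of_ge]
      linarith
    · have := p.1.2.2
      rw [ev_of_le _ (by linarith)]
      exact ev_zero_lt _
  · rintro ⟨z, ε⟩
    simp only [Set.Icc.coe_one, Set.Icc.coe_zero, sub_zero, one_smul, zero_smul, add_zero]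
    refine pcls_congr _ fun r r0 r1 => ?_
    rw [max_eq_right (a := cut _) ((ht z).trans (by norm_num)),
      tent_of_ge _ _ (le_max_left _ _), flip3_flip3]
    rcases le_total (1 / 2) r with h | h
    · rw [max_eq_right h]
    · rw [max_eq_left h, ev_of_le ε (show 2 * r - 1 ≤ 0 by linarith)]
      norm_num
  · rintro ⟨z, ε⟩
    rw [hB]
    simp only [Set.Icc.coe_zero, zero_div, max_eq_left (cut_nonneg _)]
    rw [bcls]
    split_ifs with h
    · rfl
    · refine pcls_outside (outside_cons2.2 (.inl (one_lt_norm_coneCoord (ne1 _ _ _ le_rfl) ?_ ?_).le)) _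
      · rw [tent_of_le _ _ (cut_nonneg _) (ht z)]
        dsimp only
        linarith [cut_nonneg (level 1 (head2 z))]
      · have h1 := lt1 (head2 z) ε _ le_rfl ((ht z).trans (by norm_num))
        rw [tent_of_le _ _ (cut_nonneg _) (ht z)] at h h1 ⊢
        dsimp only at h h1 ⊢
        linarith
  · rintro ⟨z, ε⟩
    simp only [Set.Icc.coe_one, sub_self, zero_smul, one_smul, zero_add, cons2_head2, id]
    rw [← pcls_ev]
    refine pcls_congr _ fun r r0 r1 => ?_
    norm_num

theorem proj_rest_extend : ∃ (U : I × PathSmash (d + 2) → SphereSp (d + 1))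
    (B : I × PathSmash (d + 2) → PathSmash (d + 2)), Continuous U ∧ Continuous B ∧
    (∀ p, U p = spherePt (d + 1) ∨ B p = smashPt (d + 2)) ∧
    (∀ y, U (0, y) = proj (extend y)) ∧ (∀ y, B (0, y) = rest (extend y)) ∧
    (∀ y, U (1, y) = spherePt (d + 1)) ∧ (∀ s, U (s, smashPt (d + 2)) = spherePt (d + 1)) ∧
    (∀ s, B (s, smashPt (d + 2)) = smashPt (d + 2)) ∧
    PHtpy (smashPt (d + 2)) (fun y => B (1, y)) id := by
  obtain ⟨U, U1, U2, U3⟩ := (collapse_cls (d + 1)).exists_lift (y₀ := spherePt (d + 1))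
    (F := fun p => cubeMap (Fin.cons (3 * level p.1 (head2 p.2.1) - 2) (tail2 p.2.1)))
    (fun s p hp => by
      rw [cubeMap_eq_base, outside_cons]
      refine (outside_iff_tail2.1 hp).imp (fun h => ?_) id
      have := level_le h s
      exact one_le_abs_of_le (by linarith))
    (continuous_cubeMap.comp (by fun_prop))
  obtain ⟨B, B1, B2, B3⟩ := (collapse_cls (d + 1)).exists_lift (y₀ := smashPt (d + 2))
    (F := fun p => bcls (tent (head2 p.2.1) p.2.2 (cut (level p.1 (head2 p.2.1)))) (tail2 p.2.1)
      fun r => flip3 (tent (head2 p.2.1) p.2.2 (max (cut (level p.1 (head2 p.2.1))) r)))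
    (fun s p hp => by
      rcases outside_iff_tail2.1 hp with h | h
      · refine bcls_of_nonpos ?_ _ _
        rw [cut_level_of_le h, tent_zero]
      · exact bcls_outside h _ _)
    (continuous_bcls (by fun_prop) (fun p => tent_deformed_ne p.1 _ _ le_rfl) (by fun_prop)
      (by fun_prop)
      (fun p => by rw [max_eq_right (cut_le_one _), tent_one, flip3_basePt])
      (fun p r _ _ => flip3_ne (tent_deformed_ne p.1 _ _ (le_max_left _ _)))
      fun p => by rw [max_eq_left (cut_nonneg _)])
  have surj := (collapse_cls (d + 1)).quot.surjective
  refine ⟨U, B, U1, B1, ?_, fun y => ?_, fun y => ?_, fun y => ?_, U3, B3,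
    deformed_extend_phtpy _ fun z ε => B2 1 (z, ε)⟩
  · rintro ⟨s, y⟩
    obtain ⟨⟨z, ε⟩, rfl⟩ := surj y
    rw [U2, B2, cubeMap_eq_base, outside_cons]
    rcases le_total (1 / 3) (level s (head2 z)) with h | h
    · right
      dsimp only
      rw [cut_of_ge h, tent_one]
      exact bcls_of_nonpos le_rfl _ _
    · exact .inl (.inl (one_le_abs_of_le (by dsimp only; linarith)))
  · obtain ⟨⟨z, ε⟩, rfl⟩ := surj y
    rw [U2, proj_extend_cls]
    rfl
  · obtain ⟨⟨z, ε⟩, rfl⟩ := surj y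
    rw [B2, rest_extend_cls]
    rfl
  · obtain ⟨⟨z, ε⟩, rfl⟩ := surj y
    rw [U2, cubeMap_eq_base, outside_cons]
    have := level_one_le (head2 z)
    exact .inl (one_le_abs_of_le (by simp only [Set.Icc.coe_one]; linarith))

end Retraction

section Termination

/-- The open upper cone around the vertical axis. -/
def InCone (x : Space3) : Prop := 2 * ‖x.1‖ < x.2

/-- Points of the path at time distance at most `δ` do not lie in opposite cones. -/
def Separated (δ : ℝ) (γ : PathSp) : Prop :=
  ∀ s s', |s - s'| ≤ δ → InCone (ev γ s) → ¬ InCone (flip3 (ev γ s'))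

theorem ratio_eq_one {x : Space3} (h : InCone x) : x.2 / ‖x‖ = 1 := by
  have h0 : 0 < x.2 := (by positivity : (0 : ℝ) ≤ 2 * ‖x.1‖).trans_lt h
  rw [norm_of_ge h.le, div_self h0.ne']

theorem ratio_flip3 (x : Space3) : (flip3 x).2 / ‖flip3 x‖ = -(x.2 / ‖x‖) := by
  simp [flip3, norm_space3, neg_div]

theorem eventually_separated (γ : PathSp) : ∃ δ > 0, ∀ᶠ γ' in 𝓝 γ, Separated δ γ' := by
  have hc : Continuous fun p : PathSp × I => (ev p.1 p.2).2 / ‖ev p.1 p.2‖ :=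
    Continuous.div (by fun_prop) (by fun_prop) fun p => norm_ne_zero_iff.2 (ev_ne _ _)
  let f : PathSp → C(I, ℝ) := fun γ => ⟨fun s => (ev γ s).2 / ‖ev γ s‖,
    hc.comp (f := fun s : I => (γ, s)) (by fun_prop)⟩
  have hf : Continuous f := ContinuousMap.continuous_of_continuous_uncurry _ hc
  have hu : UniformContinuous (f γ) := CompactSpace.uniformContinuous_of_continuous (f γ).continuous
  obtain ⟨δ, δ0, hδ⟩ := Metric.uniformContinuous_iff.1 hu 1 one_pos
  refine ⟨δ / 2, by positivity, ?_⟩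
  have hn : ∀ᶠ γ' in 𝓝 γ, dist (f γ') (f γ) < 1 / 4 :=
    hf.continuousAt.eventually (Metric.ball_mem_nhds _ (by norm_num))
  filter_upwards [hn] with γ' h s s' hs h1 h2
  set p := Set.projIcc (0 : ℝ) 1 zero_le_one with hp
  have e : ∀ r, ev γ' r = ev γ' (p r) := fun r => by rw [ev_coe]; rfl
  have e1 : f γ' (p s) = 1 := by
    have := ratio_eq_one h1
    rwa [e] at this
  have e2 : f γ' (p s') = -1 := by
    have := ratio_eq_one h2
    rw [ratio_flip3, e] at this
    exact neg_eq_iff_eq_neg.1 this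
  have d1 : dist (p s) (p s') < δ := by
    have h3 : |((p s : I) : ℝ) - p s'| ≤ |s - s'| := by
      rw [hp]
      exact Set.abs_projIcc_sub_projIcc zero_le_one
    exact lt_of_le_of_lt (h3.trans hs) (by linarith)
  have d2 := hδ d1
  have d3 := (ContinuousMap.dist_apply_le_dist (f := f γ') (g := f γ) (p s)).trans_lt h
  have d4 := (ContinuousMap.dist_apply_le_dist (f := f γ') (g := f γ) (p s')).trans_lt h
  rw [e1] at d3
  rw [e2] at d4
  rw [Real.dist_eq, abs_lt] at d2 d3 d4
  linarith [d2.1, d2.2, d3.1, d3.2, d4.1, d4.2]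

variable {d : ℕ}

theorem inCone_of_coneCoord {x : Space3} (h0 : 0 < x.2) (h : ‖coneCoord x‖ < 1) : InCone x := by
  have hx : 0 < ‖x‖ := norm_pos_iff.2 (space3_ne (.inr h0.ne'))
  rw [norm_coneCoord, div_lt_one hx, norm_space3, abs_of_pos h0, lt_max_iff] at h
  have := norm_nonneg x.1
  exact h.resolve_left (by linarith)

theorem rest_cls_cases {δ : ℝ} {γ : PathSp} (hγ : Separated δ γ) (z : Fin (d + 1) → ℝ) :
    rest (cls (z, γ)) = smashPt (d + 2) ∨ InCone (ev γ (cut (z 0))) ∧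
      ∃ w ε, rest (cls (z, γ)) = cls (w, ε) ∧ Separated δ ε ∧ InCone (flip3 (ev ε 0)) ∧
        ∀ r ≤ cut (z 0), ev ε r = ev ε 0 := by
  set τ := cut (z 0) with hτ
  have τ0 : 0 ≤ τ := cut_nonneg _
  have τ1 : τ ≤ 1 := cut_le_one _
  rw [rest_cls, bcls]
  split_ifs with h0
  swap
  · exact .inl rfl
  by_cases h1 : 1 ≤ ‖coneCoord (ev γ τ)‖
  · exact .inl (pcls_outside (outside_cons2.2 (.inl h1)) _)
  have hup := inCone_of_coneCoord h0 (not_le.1 h1)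
  have hg : Good fun s => flip3 (ev γ (max τ s)) := by
    refine ⟨Continuous.continuousOn (by fun_prop), fun s _ _ => flip3_ne (ev_ne _ _), ?_, ?_⟩
    · rw [max_eq_right τ1, ev_of_ge _ le_rfl, flip3_basePt]
    · rw [max_eq_left τ0]
      have := norm_nonneg (ev γ τ).1
      simp only [flip3]
      linarith
  have e0 : ∀ r ≤ τ, ev hg.path r = flip3 (ev γ τ) := fun r hr => by
    rw [hg.ev_path, max_eq_left]
    exact max_le τ0 (min_le_of_right_le hr)
  refine .inr ⟨hup, _, hg.path, hg.pcls_eq _, fun s s' hs h2 h3 => ?_, ?_, fun r hr => ?_⟩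
  · rw [hg.ev_path] at h2 h3
    rw [flip3_flip3] at h3
    refine hγ _ _ ?_ h3 h2
    rw [abs_sub_comm]
    refine (abs_max_sub_max_le_max _ _ _ _).trans (max_le (by simpa using (abs_nonneg _).trans hs) ?_)
    unfold clamp
    refine (abs_max_sub_max_le_max _ _ _ _).trans (max_le (by simpa using (abs_nonneg _).trans hs) ?_)
    exact (abs_min_sub_min_le_max _ _ _ _).trans (max_le (by simpa using (abs_nonneg _).trans hs) hs)
  · rw [e0 0 τ0, flip3_flip3]
    exact hup
  · rw [e0 r hr, e0 0 τ0]

/-- The sequence of half-smashes with the maps that split off one sphere at a time. -/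
def smashTower (n₀ : ℕ) : Tower (fun n => PathSmash (n₀ + n + 1)) (fun n => SphereSp (n₀ + n + 1))
    (fun n => smashPt (n₀ + n + 1)) (fun n => spherePt (n₀ + n + 1)) where
  i _ := inc
  a n := extend (d := n₀ + n)
  u _ := proj
  b n := rest (d := n₀ + n)
  closed_a₀ n := (collapse_cls (n₀ + n)).isClosed_base ((isClosed_outside _).preimage continuous_fst)
  closed_s₀ n := isClosed_singleton
  cont_i _ := continuous_inc
  cont_a n := continuous_extend (d := n₀ + n)
  cont_u _ := continuous_proj
  cont_b n := continuous_rest (d := n₀ + n)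
  i_base _ := rfl
  a_base n := extend_base (d := n₀ + n)
  u_base _ := proj_base
  b_base n := rest_base (d := n₀ + n)
  disj n x := proj_or_rest (d := n₀ + n) x
  b_i n s := rest_inc (d := n₀ + n) s
  decomp n := by convert smash_decomposition (d := n₀ + n)
  u_i _ := proj_inc
  u_a n := proj_rest_extend (d := n₀ + n)

theorem dies_base (n₀ : ℕ) : ∀ M n, (smashTower n₀).Dies M n (smashPt (n₀ + n + 1))
  | 0, _ => rfl
  | M + 1, n => (dies_base n₀ M n).succ

theorem dies_of_inCone (n₀ : ℕ) {δ : ℝ} : ∀ (M n : ℕ) (z : Fin (n₀ + n + 1) → ℝ) (γ : PathSp) (c : ℝ),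
    0 ≤ δ → Separated δ γ → InCone (flip3 (ev γ 0)) → (∀ r ≤ c, ev γ r = ev γ 0) → 1 ≤ c + M * δ →
    (smashTower n₀).Dies M n (cls (z, γ))
  | 0, n, z, γ, c, _, _, h, hc, h1 => by
    exfalso
    rw [← hc 1 (by simpa using h1), ev_of_ge _ le_rfl, flip3_basePt] at h
    simp only [InCone, norm_basePt_fst] at h
    norm_num [basePt] at h
  | M + 1, n, z, γ, c, hδ, hs, h, hc, h1 => by
    change (smashTower n₀).Dies M (n + 1) (rest (d := n₀ + n) (cls (z, γ)))
    rcases rest_cls_cases hs z with e | ⟨hup, w, ε, e, h2, h3, h4⟩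
    · rw [e]
      exact dies_base n₀ M (n + 1)
    · rw [e]
      refine dies_of_inCone n₀ M (n + 1) w ε _ hδ h2 h3 h4 ?_
      by_contra! h5
      push_cast at h1
      refine hs (cut (z 0)) (min c (cut (z 0))) ?_ hup ?_
      · rcases le_total c (cut (z 0)) with h6 | h6
        · rw [min_eq_left h6, abs_of_nonneg (by linarith)]
          linarith
        · rw [min_eq_right h6, sub_self, abs_zero]
          exact hδ
      · rw [hc _ (min_le_left _ _)]
        exact h

theorem pathSmash_phe_wedge (n₀ : ℕ) : PHE (smashPt (n₀ + 1))
    (Quot.mk _ ⟨0, spherePt (n₀ + 1)⟩ : WedgeFam ℕ (fun k => SphereSp (n₀ + k + 1))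
      (fun k => spherePt (n₀ + k + 1))) := by
  refine (smashTower n₀).phe_wedge (q := fun n => cls)
    (fun n => (collapse_cls (n₀ + n)).quot) fun n x => ?_
  obtain ⟨δ, δ0, hδ⟩ := eventually_separated x.2
  obtain ⟨M, hM⟩ := exists_nat_ge (1 / δ)
  refine ⟨M + 1, (continuous_snd.continuousAt.eventually hδ).mono fun p hp => ?_⟩
  change (smashTower n₀).Dies M (n + 1) (rest (d := n₀ + n) (cls (p.1, p.2)))
  rcases rest_cls_cases hp p.1 with e | ⟨-, w, ε, e, h2, h3, h4⟩
  · rw [e]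
    exact dies_base n₀ M (n + 1)
  · rw [e]
    refine dies_of_inCone n₀ M (n + 1) w ε _ δ0.le h2 h3 h4 ?_
    have := cut_nonneg (p.1 0)
    rw [div_le_iff₀ δ0] at hM
    linarith

end Termination

section Loops

/-- Points of the half-space coordinates as points of the Euclidean space. -/
def toEuclidean3 (x : Space3) : EuclideanSpace ℝ (Fin 3) := WithLp.toLp 2 ![x.1.1, x.1.2, x.2]

/-- The inverse of `toEuclidean3`. -/
def ofEuclidean3 (e : EuclideanSpace ℝ (Fin 3)) : Space3 := ((e 0, e 1), e 2)

theorem toEuclidean3_ofEuclidean3 (e : EuclideanSpace ℝ (Fin 3)) :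
    toEuclidean3 (ofEuclidean3 e) = e := by
  ext i
  fin_cases i <;> rfl

theorem ofEuclidean3_toEuclidean3 (x : Space3) : ofEuclidean3 (toEuclidean3 x) = x := rfl

theorem ofEuclidean3_smul (c : ℝ) (e : EuclideanSpace ℝ (Fin 3)) :
    ofEuclidean3 (c • e) = c • ofEuclidean3 e := rfl

@[fun_prop]
theorem continuous_toEuclidean3 : Continuous toEuclidean3 := by
  refine (PiLp.continuous_toLp 2 _).comp (continuous_pi fun i => ?_)
  fin_cases i
  · exact continuous_fst.comp continuous_fst
  · exact continuous_snd.comp continuous_fst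
  · exact continuous_snd

@[fun_prop]
theorem continuous_ofEuclidean3 : Continuous ofEuclidean3 := by
  unfold ofEuclidean3
  fun_prop

theorem toEuclidean3_ne {x : Space3} (h : x ≠ 0) : toEuclidean3 x ≠ 0 := fun e => h (by
  rw [← ofEuclidean3_toEuclidean3 x, e]
  rfl)

theorem toEuclidean3_basePt : toEuclidean3 basePt = (spherePt 2).1 := by
  ext i
  fin_cases i <;> simp [toEuclidean3, basePt, spherePt]

theorem ofEuclidean3_spherePt : ofEuclidean3 (spherePt 2).1 = basePt := by
  rw [← toEuclidean3_basePt, ofEuclidean3_toEuclidean3]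

theorem norm_toEuclidean3_basePt : ‖toEuclidean3 basePt‖ = 1 := by
  rw [toEuclidean3_basePt]
  exact mem_sphere_zero_iff_norm.1 (spherePt 2).2

open Classical in
/-- Radial projection to the sphere. -/
def toSphere2 (x : Space3) : SphereSp 2 :=
  if h : x = 0 then spherePt 2 else ⟨‖toEuclidean3 x‖⁻¹ • toEuclidean3 x, by
    rw [mem_sphere_zero_iff_norm, norm_smul, norm_inv, norm_norm,
      inv_mul_cancel₀ (norm_ne_zero_iff.2 (toEuclidean3_ne h))]⟩

theorem toSphere2_coe {x : Space3} (h : x ≠ 0) :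
    (toSphere2 x).1 = ‖toEuclidean3 x‖⁻¹ • toEuclidean3 x := by
  rw [toSphere2, dif_neg h]

theorem toSphere2_ofEuclidean3 (e : SphereSp 2) : toSphere2 (ofEuclidean3 e.1) = e := by
  have he : ‖e.1‖ = 1 := mem_sphere_zero_iff_norm.1 e.2
  have h : ofEuclidean3 e.1 ≠ 0 := fun h => by
    rw [← toEuclidean3_ofEuclidean3 e.1, h] at he
    have : toEuclidean3 0 = 0 := by
      ext i
      fin_cases i <;> rfl
    simp [this] at he
  refine Subtype.ext ?_
  rw [toSphere2_coe h, toEuclidean3_ofEuclidean3, he, inv_one, one_smul]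

theorem toSphere2_basePt : toSphere2 basePt = spherePt 2 := by
  rw [← ofEuclidean3_spherePt, toSphere2_ofEuclidean3]

theorem Continuous.toSphere2 {Y : Type*} [TopologicalSpace Y] {x : Y → Space3}
    (hx : Continuous x) (h : ∀ y, x y ≠ 0) : Continuous fun y => toSphere2 (x y) := by
  refine continuous_induced_rng.2 ?_
  have : Continuous fun y => ‖toEuclidean3 (x y)‖⁻¹ • toEuclidean3 (x y) :=
    (Continuous.inv₀ (by fun_prop) fun y => norm_ne_zero_iff.2 (toEuclidean3_ne (h y))).smul
      (by fun_prop)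
  exact this.congr fun y => (toSphere2_coe (h y)).symm

theorem PathSp.ext' {γ γ' : PathSp} (h : ∀ s, 0 ≤ s → s ≤ 1 → ev γ s = ev γ' s) : γ = γ' :=
  Subtype.ext (ContinuousMap.ext fun s => by
    have := h s s.2.1 s.2.2
    rwa [ev_coe, ev_coe] at this)

theorem Good.continuous_path {Y : Type*} [TopologicalSpace Y] {φ : Y → ℝ → Space3}
    (hφ : Continuous fun p : Y × ℝ => φ p.1 p.2) (hg : ∀ y, Good (φ y)) :
    Continuous fun y => (hg y).path := by
  let w : Y → C(I, Space3) := fun y => ⟨fun s => φ y s, by fun_prop⟩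
  have hw : Continuous w := ContinuousMap.continuous_of_continuous_uncurry _
    (hφ.comp (f := fun p : Y × I => (p.1, (p.2 : ℝ))) (by fun_prop))
  exact Continuous.subtype_mk hw _

theorem homotopic_path {Y : Type*} [TopologicalSpace Y] {φ : I × Y → ℝ → Space3}
    (hφ : Continuous fun p : (I × Y) × ℝ => φ p.1 p.2) (hg : ∀ y, Good (φ y)) {f g : C(Y, PathSp)}
    (h0 : ∀ y s, 0 ≤ s → s ≤ 1 → φ (0, y) s = ev (f y) s)
    (h1 : ∀ y s, 0 ≤ s → s ≤ 1 → φ (1, y) s = ev (g y) s) : f.Homotopic g :=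
  ⟨⟨⟨fun y => (hg y).path, Good.continuous_path hφ hg⟩,
    fun y => PathSp.ext' fun s s0 s1 => by
      rw [← h0 y s s0 s1]
      exact ((hg (0, y)).ev_path s).trans (by rw [clamp_of_mem s0 s1]),
    fun y => PathSp.ext' fun s s0 s1 => by
      rw [← h1 y s s0 s1]
      exact ((hg (1, y)).ev_path s).trans (by rw [clamp_of_mem s0 s1])⟩⟩

/-- The condition on a function to give a loop by radial projection. -/
structure GoodLoop (φ : ℝ → Space3) : Prop where
  cont : Continuous φ
  ne : ∀ s, 0 ≤ s → φ s ≠ 0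
  zero : φ 0 = basePt
  one : φ 1 = basePt

/-- The loop given by a function on the reals. -/
def GoodLoop.loop {φ : ℝ → Space3} (h : GoodLoop φ) : LoopSp (SphereSp 2) (spherePt 2) :=
  ⟨⟨fun s : I => toSphere2 (φ s), Continuous.toSphere2 (h.cont.comp continuous_subtype_val)
    fun s => h.ne s s.2.1⟩, by simp [h.zero, toSphere2_basePt], by simp [h.one, toSphere2_basePt]⟩

theorem GoodLoop.continuous_loop {Y : Type*} [TopologicalSpace Y] {φ : Y → ℝ → Space3}
    (hφ : Continuous fun p : Y × ℝ => φ p.1 p.2) (hg : ∀ y, GoodLoop (φ y)) :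
    Continuous fun y => (hg y).loop :=
  Continuous.subtype_mk (ContinuousMap.continuous_of_continuous_uncurry _
    (Continuous.toSphere2 (hφ.comp (f := fun p : Y × I => (p.1, (p.2 : ℝ))) (by fun_prop))
      fun p => (hg p.1).ne p.2 p.2.2.1)) _

theorem homotopic_loop {Y : Type*} [TopologicalSpace Y] {φ : I × Y → ℝ → Space3}
    (hφ : Continuous fun p : (I × Y) × ℝ => φ p.1 p.2) (hg : ∀ y, GoodLoop (φ y))
    {f g : C(Y, LoopSp (SphereSp 2) (spherePt 2))}
    (h0 : ∀ y (s : I), toSphere2 (φ (0, y) s) = (f y).1 s)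
    (h1 : ∀ y (s : I), toSphere2 (φ (1, y) s) = (g y).1 s) : f.Homotopic g :=
  ⟨⟨⟨fun y => (hg y).loop, GoodLoop.continuous_loop hφ hg⟩,
    fun y => Subtype.ext (ContinuousMap.ext fun s => h0 y s),
    fun y => Subtype.ext (ContinuousMap.ext fun s => h1 y s)⟩⟩

/-- Evaluation of a loop, extended to all reals by constants. -/
def loopEv (w : LoopSp (SphereSp 2) (spherePt 2)) (r : ℝ) : Space3 :=
  ofEuclidean3 (w.1 (Set.projIcc 0 1 zero_le_one r)).1

@[fun_prop]
theorem Continuous.loopEv {Y : Type*} [TopologicalSpace Y]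
    {w : Y → LoopSp (SphereSp 2) (spherePt 2)} {r : Y → ℝ}
    (hw : Continuous w) (hr : Continuous r) : Continuous fun y => loopEv (w y) (r y) := by
  have h1 : Continuous fun y => (w y).1 := continuous_subtype_val.comp hw
  have h2 : Continuous fun y => Set.projIcc (0 : ℝ) 1 zero_le_one (r y) :=
    continuous_projIcc.comp hr
  exact continuous_ofEuclidean3.comp (continuous_subtype_val.comp (h1.eval h2))

theorem loopEv_coe (w : LoopSp (SphereSp 2) (spherePt 2)) (s : I) :
    toSphere2 (loopEv w s) = w.1 s := by
  rw [loopEv, toSphere2_ofEuclidean3, Set.projIcc_val]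

theorem loopEv_ne (w : LoopSp (SphereSp 2) (spherePt 2)) (r : ℝ) : loopEv w r ≠ 0 := fun h => by
  have he := mem_sphere_zero_iff_norm.1 (w.1 (Set.projIcc 0 1 zero_le_one r)).2
  rw [← toEuclidean3_ofEuclidean3 (w.1 (Set.projIcc 0 1 zero_le_one r)).1, ← loopEv, h] at he
  have : toEuclidean3 0 = 0 := by
    ext i
    fin_cases i <;> rfl
  simp [this] at he

theorem loopEv_of_le (w : LoopSp (SphereSp 2) (spherePt 2)) {r : ℝ} (h : r ≤ 0) :
    loopEv w r = basePt := by
  rw [loopEv, Set.projIcc_of_le_left _ h]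
  exact (congrArg (fun e : SphereSp 2 => ofEuclidean3 e.1) w.2.1).trans ofEuclidean3_spherePt

theorem loopEv_of_ge (w : LoopSp (SphereSp 2) (spherePt 2)) {r : ℝ} (h : 1 ≤ r) :
    loopEv w r = basePt := by
  rw [loopEv, Set.projIcc_of_right_le _ h]
  exact (congrArg (fun e : SphereSp 2 => ofEuclidean3 e.1) w.2.2).trans ofEuclidean3_spherePt

theorem good_loopEv (w : LoopSp (SphereSp 2) (spherePt 2)) : Good (loopEv w) where
  cont := Continuous.continuousOn (by fun_prop)
  ne s _ _ := loopEv_ne w s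
  one := loopEv_of_ge w le_rfl
  zero := by
    rw [loopEv_of_le w le_rfl]
    simp [basePt]

/-- The path closed up to a loop at the base point. -/
def closeUp (γ : PathSp) (s : ℝ) : Space3 := flip3 (tent (1, 0) γ s)

@[fun_prop]
theorem Continuous.closeUp {Y : Type*} [TopologicalSpace Y] {γ : Y → PathSp} {s : Y → ℝ}
    (hγ : Continuous γ) (hs : Continuous s) : Continuous fun y => closeUp (γ y) (s y) := by
  unfold _root_.closeUp
  fun_prop

theorem closeUp_ne (γ : PathSp) {s : ℝ} (h : 0 ≤ s) : closeUp γ s ≠ 0 :=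
  flip3_ne (tent_ne _ _ h (.inl (by simp)))

theorem closeUp_one (γ : PathSp) : closeUp γ 1 = basePt := by
  rw [closeUp, tent_one, flip3_basePt]

theorem closeUp_zero (γ : PathSp) : closeUp γ 0 = basePt := by
  rw [closeUp, tent_zero]
  simp [flip3, basePt]

theorem closeUp_of_ge (γ : PathSp) {s : ℝ} (h : 1 / 2 ≤ s) : closeUp γ s = ev γ (2 * s - 1) := by
  rw [closeUp, tent_of_ge _ _ h, flip3_flip3]

theorem closeUp_lt (γ : PathSp) {s : ℝ} (h0 : 0 ≤ s) (h1 : s ≤ 1 / 2) :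
    (closeUp γ s).2 < 2 * ‖(closeUp γ s).1‖ :=
  tent_lt _ _ h0 h1 (.inl (by simp))

theorem goodLoop_closeUp (γ : PathSp) : GoodLoop (closeUp γ) where
  cont := by fun_prop
  ne _ h := closeUp_ne γ h
  zero := closeUp_zero γ
  one := closeUp_one γ

theorem closeUp_fst_nonneg {γ : PathSp} (h : ev γ 0 = basePt) {s : ℝ} (h0 : 0 ≤ s)
    (h1 : s ≤ 1 / 2) : 0 ≤ (closeUp γ s).1.1 := by
  rcases le_total s (1 / 4) with h2 | h2
  · rw [closeUp, tent_of_le _ _ h0 h2]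
    simp only [flip3, Prod.smul_mk, smul_eq_mul]
    linarith
  · rw [closeUp, tent_of_mid _ _ h2 h1, h]
    simp only [flip3, basePt, Prod.smul_mk, smul_eq_mul]
    linarith

theorem good_ev_affine (γ : PathSp) (n : I) :
    Good fun s => ev γ ((2 - n) * s - (1 - n)) where
  cont := Continuous.continuousOn (by fun_prop)
  ne s _ _ := ev_ne γ _
  one := ev_of_ge γ (by linarith)
  zero := by
    rw [ev_of_le γ (by linarith [n.2.2])]
    exact ev_zero_lt γ

theorem good_scaled (γ : PathSp) (l : I) : Good fun s =>
    ((1 - l) * ‖toEuclidean3 (closeUp γ (max 0 s))‖⁻¹ + l : ℝ) • closeUp γ (max 0 s) where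
  cont := Continuous.continuousOn (by
    have : Continuous fun s : ℝ => ‖toEuclidean3 (closeUp γ (max 0 s))‖⁻¹ :=
      Continuous.inv₀ (by fun_prop) fun s =>
        norm_ne_zero_iff.2 (toEuclidean3_ne (closeUp_ne γ (le_max_left _ _)))
    fun_prop)
  ne s _ _ := by
    refine smul_ne_zero (ne_of_gt ?_) (closeUp_ne γ (le_max_left _ _))
    have h1 : 0 < ‖toEuclidean3 (closeUp γ (max 0 s))‖⁻¹ :=
      inv_pos.2 (norm_pos_iff.2 (toEuclidean3_ne (closeUp_ne γ (le_max_left _ _))))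
    rcases l.2.1.eq_or_lt with h2 | h2
    · rw [← h2]
      simpa using h1
    · have := mul_nonneg (sub_nonneg.2 l.2.2) h1.le
      linarith
  one := by
    rw [max_eq_right zero_le_one, closeUp_one, norm_toEuclidean3_basePt]
    simp
  zero := by
    rw [max_eq_left le_rfl, closeUp_zero, norm_toEuclidean3_basePt]
    simp [basePt]

theorem good_closeUp_max (γ : PathSp) (n : I) : Good fun s => closeUp γ (max s (n / 2)) where
  cont := Continuous.continuousOn (by fun_prop)
  ne s h _ := closeUp_ne γ (h.trans (le_max_left _ _))
  one := by rw [max_eq_left (by linarith [n.2.2]), closeUp_one]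
  zero := by
    rw [max_eq_right (by linarith [n.2.1])]
    exact closeUp_lt γ (by linarith [n.2.1]) (by linarith [n.2.2])

theorem goodLoop_loopEv_affine (w : LoopSp (SphereSp 2) (spherePt 2)) (n : I) :
    GoodLoop fun s => loopEv w ((2 - n) * s - (1 - n)) where
  cont := by fun_prop
  ne s _ := loopEv_ne w _
  one := loopEv_of_ge w (by linarith)
  zero := loopEv_of_le w (by linarith [n.2.2])

theorem goodLoop_blend {γ : PathSp} {w : LoopSp (SphereSp 2) (spherePt 2)}
    (h : ∀ r ≤ 1, ev γ r = loopEv w r) (l : I) :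
    GoodLoop fun s => (1 - l : ℝ) • closeUp γ s + (l : ℝ) • loopEv w (2 * s - 1) where
  cont := by fun_prop
  ne s hs := by
    rcases le_total s (1 / 2) with h2 | h2
    · rw [loopEv_of_le w (by linarith)]
      have h3 := closeUp_fst_nonneg ((h 0 zero_le_one).trans (loopEv_of_le w le_rfl)) hs h2
      rcases l.2.1.eq_or_lt with h4 | h4
      · rw [← h4]
        simpa using closeUp_ne γ hs
      · intro h5
        have h6 := congrArg (fun x : Space3 => x.1.1) h5
        simp [basePt] at h6
        have := mul_nonneg (sub_nonneg.2 l.2.2) h3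
        linarith
    · have : closeUp γ s = loopEv w (2 * s - 1) := by
        rw [closeUp_of_ge γ h2]
        rcases le_total (2 * s - 1) 1 with h3 | h3
        · exact h _ h3
        · rw [ev_of_ge _ h3, loopEv_of_ge _ h3]
      rw [this, ← add_smul, sub_add_cancel, one_smul]
      exact loopEv_ne _ _
  zero := by
    rw [closeUp_zero, loopEv_of_le w (by norm_num), ← add_smul, sub_add_cancel, one_smul]
  one := by
    rw [closeUp_one, loopEv_of_ge w (by norm_num), ← add_smul, sub_add_cancel, one_smul]

theorem homotopyEquiv_path_loop :
    Nonempty (ContinuousMap.HomotopyEquiv PathSp (LoopSp (SphereSp 2) (spherePt 2))) := by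
  let f : C(PathSp, LoopSp (SphereSp 2) (spherePt 2)) :=
    ⟨fun γ => (goodLoop_closeUp γ).loop, GoodLoop.continuous_loop (by fun_prop) _⟩
  let g : C(LoopSp (SphereSp 2) (spherePt 2), PathSp) :=
    ⟨fun w => (good_loopEv w).path, Good.continuous_path (by fun_prop) _⟩
  have hg : ∀ w r, ev (g w) r = loopEv w (clamp r) := fun w r => rfl
  have hg' : ∀ w, ∀ r ≤ 1, ev (g w) r = loopEv w r := fun w r h => by
    rcases le_total r 0 with h' | h'
    · rw [hg, clamp_of_le h', loopEv_of_le w le_rfl, loopEv_of_le w h']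
    · rw [hg, clamp_of_mem h' h]
  have hf : ∀ γ (s : I), (f γ).1 s = toSphere2 (closeUp γ s) := fun γ s => rfl
  have hgf : ∀ γ s, 0 ≤ s → s ≤ 1 → ev (g (f γ)) s =
      ‖toEuclidean3 (closeUp γ s)‖⁻¹ • closeUp γ s := fun γ s s0 s1 => by
    rw [hg' _ _ s1, loopEv, Set.projIcc_of_mem _ ⟨s0, s1⟩, hf, toSphere2_coe (closeUp_ne γ s0),
      ofEuclidean3_smul, ofEuclidean3_toEuclidean3]
  let k : C(PathSp, PathSp) := ⟨fun γ => (good_closeUp_max γ 0).path,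
    Good.continuous_path (by fun_prop) _⟩
  have hk : ∀ γ s, 0 ≤ s → s ≤ 1 → ev (k γ) s = closeUp γ s := fun γ s s0 s1 => by
    refine ((good_closeUp_max γ 0).ev_path s).trans ?_
    rw [clamp_of_mem s0 s1]
    simp [s0]
  let j : C(PathSp, PathSp) := ⟨fun γ => (good_ev_affine γ 0).path,
    Good.continuous_path (by fun_prop) _⟩
  have hj : ∀ γ s, 0 ≤ s → s ≤ 1 → ev (j γ) s = ev γ (2 * s - 1) := fun γ s s0 s1 => by
    refine ((good_ev_affine γ 0).ev_path s).trans ?_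
    rw [clamp_of_mem s0 s1]
    simp
  have a1 : (g.comp f).Homotopic k := by
    refine homotopic_path (φ := fun p s => ((1 - p.1) * ‖toEuclidean3 (closeUp p.2 (max 0 s))‖⁻¹ +
      p.1 : ℝ) • closeUp p.2 (max 0 s)) ?_ (fun p => good_scaled p.2 p.1) (fun γ s s0 s1 => ?_)
      fun γ s s0 s1 => ?_
    · have : Continuous fun p : (I × PathSp) × ℝ =>
          ‖toEuclidean3 (closeUp p.1.2 (max 0 p.2))‖⁻¹ :=
        Continuous.inv₀ (by fun_prop) fun s =>
          norm_ne_zero_iff.2 (toEuclidean3_ne (closeUp_ne _ (le_max_left _ _)))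
      fun_prop
    · refine Eq.trans ?_ (hgf γ s s0 s1).symm
      simp [s0]
    · rw [hk γ s s0 s1]
      simp [s0]
  have a2 : k.Homotopic j := by
    refine homotopic_path (φ := fun p s => closeUp p.2 (max s (p.1 / 2))) (by fun_prop)
      (fun p => good_closeUp_max p.2 p.1) (fun γ s s0 s1 => ?_) fun γ s s0 s1 => ?_
    · rw [hk γ s s0 s1]
      simp [s0]
    · rw [hj γ s s0 s1]
      dsimp only
      rw [closeUp_of_ge _ (by simp)]
      rcases le_total s (1 / 2) with h | h
      · rw [ev_of_le γ (r := 2 * s - 1) (by linarith), ev_of_le]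
        rw [Set.Icc.coe_one, max_eq_right h]
        norm_num
      · rw [Set.Icc.coe_one, max_eq_left h]
  have a3 : j.Homotopic (ContinuousMap.id _) := by
    refine homotopic_path (φ := fun p s => ev p.2 ((2 - p.1) * s - (1 - p.1))) (by fun_prop)
      (fun p => good_ev_affine p.2 p.1) (fun γ s s0 s1 => ?_) fun γ s s0 s1 => ?_
    · rw [hj γ s s0 s1]
      simp
    · norm_num
  let i : C(LoopSp (SphereSp 2) (spherePt 2), LoopSp (SphereSp 2) (spherePt 2)) :=
    ⟨fun w => (goodLoop_loopEv_affine w 0).loop, GoodLoop.continuous_loop (by fun_prop) _⟩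
  have b1 : (f.comp g).Homotopic i := by
    refine homotopic_loop (φ := fun p s => (1 - p.1 : ℝ) • closeUp (g p.2) s +
      (p.1 : ℝ) • loopEv p.2 (2 * s - 1)) (by fun_prop)
      (fun p => goodLoop_blend (hg' p.2) p.1) (fun w s => ?_) fun w s => ?_
    · refine Eq.trans ?_ (hf (g w) s).symm
      simp
    · change _ = toSphere2 _
      simp
  have b2 : i.Homotopic (ContinuousMap.id _) := by
    refine homotopic_loop (φ := fun p s => loopEv p.2 ((2 - p.1) * s - (1 - p.1))) (by fun_prop)
      (fun p => goodLoop_loopEv_affine p.2 p.1) (fun w s => rfl) fun w s => ?_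
    refine Eq.trans ?_ (loopEv_coe w s)
    norm_num
  exact ⟨⟨f, g, (a1.trans a2).trans a3, b1.trans b2⟩⟩

end Loops

section HalfSmash

variable {X Y : Type*} [TopologicalSpace X] [TopologicalSpace Y] {x₀ : X}

theorem continuous_halfSmash_prod {T Z : Type*} [TopologicalSpace T] [TopologicalSpace Z]
    [LocallyCompactSpace T] {F : T × HalfSmash X Y x₀ → Z}
    (h : Continuous fun p : T × (X × Y) => F (p.1, Quot.mk _ p.2)) : Continuous F :=
  isQuotientMap_quot_mk.continuous_lift_prod_right h

/-- The map of half-smashes induced by a map of the unpointed factors. -/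
def halfSmashMap {Y' : Type*} (f : Y → Y') :
    Quot (fun u v : X × Y => u.1 = x₀ ∧ v.1 = x₀) → Quot (fun u v : X × Y' => u.1 = x₀ ∧ v.1 = x₀) :=
  Quot.map (fun p => (p.1, f p.2)) fun _ _ h => h

theorem phtpy_halfSmashMap {Y' : Type*} [TopologicalSpace Y'] (y₀ : Y) {f g : C(Y, Y')}
    (h : f.Homotopic g) : PHtpy (Quot.mk _ (x₀, y₀) : HalfSmash X Y x₀)
      (halfSmashMap f : _ → HalfSmash X Y' x₀) (halfSmashMap g) := by
  obtain ⟨H⟩ := h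
  refine ⟨fun p => halfSmashMap (fun y => H (p.1, y)) p.2, continuous_halfSmash_prod ?_, ?_, ?_,
    fun s => Quot.sound ⟨rfl, rfl⟩⟩
  · exact continuous_quot_mk.comp (f := fun p : I × (X × Y) => (p.2.1, H (p.1, p.2.2)))
      (by fun_prop)
  · rintro ⟨x, y⟩
    simp [halfSmashMap, Quot.map]
  · rintro ⟨x, y⟩
    simp [halfSmashMap, Quot.map]

theorem continuous_halfSmashMap {Y' : Type*} [TopologicalSpace Y'] (f : C(Y, Y')) :
    Continuous (halfSmashMap f : HalfSmash X Y x₀ → HalfSmash X Y' x₀) :=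
  continuous_quot_lift _ (continuous_quot_mk.comp (by fun_prop))

/-- A homotopy equivalence of the unpointed factors gives one of the half-smashes. -/
theorem PHE.halfSmash_right {Y' : Type*} [TopologicalSpace Y'] (x₀ : X)
    (e : ContinuousMap.HomotopyEquiv Y Y') (y₀ : Y) (y₀' : Y') :
    PHE (Quot.mk _ (x₀, y₀) : HalfSmash X Y x₀) (Quot.mk _ (x₀, y₀') : HalfSmash X Y' x₀) := by
  refine ⟨halfSmashMap e.toFun, halfSmashMap e.invFun, continuous_halfSmashMap _,
    continuous_halfSmashMap _, Quot.sound ⟨rfl, rfl⟩, Quot.sound ⟨rfl, rfl⟩, ?_, ?_⟩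
  · convert phtpy_halfSmashMap (x₀ := x₀) y₀ e.left_inv using 1
    · ext ⟨x, y⟩
      rfl
    · ext ⟨x, y⟩
      rfl
  · convert phtpy_halfSmashMap (x₀ := x₀) y₀' e.right_inv using 1
    · ext ⟨x, y⟩
      rfl
    · ext ⟨x, y⟩
      rfl

/-- A pointed homeomorphism of the pointed factors gives one of the half-smashes. -/
theorem PHE.halfSmash_left {X' : Type*} [TopologicalSpace X'] {x₀' : X'} (e : X ≃ₜ X')
    (he : e x₀ = x₀') (y₀ : Y) :
    PHE (Quot.mk _ (x₀, y₀) : HalfSmash X Y x₀) (Quot.mk _ (x₀', y₀) : HalfSmash X' Y x₀') := by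
  subst he
  refine PHE.of_homeomorph ⟨⟨Quot.map (fun p => (e p.1, p.2)) fun _ _ h => by simpa using h,
    Quot.map (fun p => (e.symm p.1, p.2)) fun _ _ h => by simp [h], ?_, ?_⟩, ?_, ?_⟩ rfl
  · rintro ⟨x, y⟩
    simp [Quot.map]
  · rintro ⟨x, y⟩
    simp [Quot.map]
  · exact continuous_quot_lift _ (continuous_quot_mk.comp (by fun_prop))
  · exact continuous_quot_lift _ (continuous_quot_mk.comp (by fun_prop))

end HalfSmash

section FiniteWedge

variable {ι : Type*} {X : ι → Type*} [∀ i, TopologicalSpace (X i)] {pt : ∀ i, X i}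

theorem wedge_mk_eq_iff {ι : Type*} {X : ι → Type*} {pt : ∀ i, X i} {u v : Σ i, X i} : (Quot.mk (fun u v : Σ i, X i => u.2 = pt u.1 ∧ v.2 = pt v.1) u) =
    Quot.mk _ v ↔ u = v ∨ (u.2 = pt u.1 ∧ v.2 = pt v.1) := by
  constructor
  · intro h
    have := Quot.eqvGen_exact h
    induction this with
    | rel _ _ h' => exact .inr h'
    | refl => exact .inl rfl
    | symm x y h1 h2 => rcases h2 (Quot.eqvGen_sound h1) with h | h <;> simp [h]
    | trans x y z h1 h2 ih1 ih2 =>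
      rcases ih1 (Quot.eqvGen_sound h1) with rfl | h <;>
      rcases ih2 (Quot.eqvGen_sound h2) with rfl | h' <;> simp [*]
  · rintro (rfl | h)
    · rfl
    · exact Quot.sound h

variable [Finite ι] [∀ i, T2Space (X i)]

theorem isProperMap_wedge_mk :
    IsProperMap (Quot.mk _ : (Σ i, X i) → WedgeFam ι X pt) := by
  have hfin : {u : Σ i, X i | u.2 = pt u.1}.Finite :=
    (Set.finite_range fun i => (⟨i, pt i⟩ : Σ i, X i)).subset (by
      rintro ⟨i, x⟩ h
      exact ⟨i, congrArg _ (Eq.symm h)⟩)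
  refine isProperMap_iff_isClosedMap_and_compact_fibers.2 ⟨continuous_quot_mk, fun C hC => ?_, ?_⟩
  · refine isQuotientMap_quot_mk.isClosed_preimage.1 ?_
    by_cases h : ∃ u ∈ C, u.2 = pt u.1
    · obtain ⟨u, hu, hu'⟩ := h
      convert hC.union hfin.isClosed using 1
      ext v
      simp only [Set.mem_preimage, Set.mem_image, wedge_mk_eq_iff, Set.mem_union, Set.mem_ofPred_eq]
      constructor
      · rintro ⟨w, hw, rfl | h⟩
        · exact .inl hw
        · exact .inr h.2
      · rintro (h | h)
        · exact ⟨v, h, .inl rfl⟩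
        · exact ⟨u, hu, .inr ⟨hu', h⟩⟩
    · convert hC using 1
      ext v
      simp only [Set.mem_preimage, Set.mem_image, wedge_mk_eq_iff]
      constructor
      · rintro ⟨w, hw, rfl | h'⟩
        · exact hw
        · exact absurd ⟨w, hw, h'.1⟩ h
      · exact fun h => ⟨v, h, .inl rfl⟩
  · rintro ⟨u⟩
    refine (((Set.finite_singleton u).union hfin).subset ?_).isCompact
    intro v hv
    rcases wedge_mk_eq_iff.1 hv with rfl | h
    · exact .inl rfl
    · exact .inr h.1

/-- The half-smash of a finite wedge is the wedge of the half-smashes. -/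
theorem PHE.halfSmash_wedge {Y : Type*} [TopologicalSpace Y] (i₀ : ι) (y₀ : Y) :
    PHE (Quot.mk _ (Quot.mk _ ⟨i₀, pt i₀⟩, y₀) :
        HalfSmash (WedgeFam ι X pt) Y (Quot.mk _ ⟨i₀, pt i₀⟩))
      (Quot.mk _ ⟨i₀, Quot.mk _ (pt i₀, y₀)⟩ :
        WedgeFam ι (fun i => HalfSmash (X i) Y (pt i)) (fun i => Quot.mk _ (pt i, y₀))) := by
  have e : ∀ i y, (Quot.mk _ ⟨i, Quot.mk _ (pt i, y)⟩ : WedgeFam ι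
      (fun i => HalfSmash (X i) Y (pt i)) (fun i => Quot.mk _ (pt i, y₀))) =
      Quot.mk _ ⟨i₀, Quot.mk _ (pt i₀, y₀)⟩ := fun i y =>
    Quot.sound ⟨Quot.sound ⟨rfl, rfl⟩, rfl⟩
  have e' : ∀ i (x : X i), (Quot.mk _ ⟨i, x⟩ : WedgeFam ι X pt) = Quot.mk _ ⟨i₀, pt i₀⟩ →
      x = pt i := fun i x h => by
    rcases wedge_mk_eq_iff.1 h with h | h
    · cases h
      rfl
    · exact h.1
  let G : WedgeFam ι X pt × Y → WedgeFam ι (fun i => HalfSmash (X i) Y (pt i))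
      (fun i => Quot.mk _ (pt i, y₀)) := fun p =>
    wedgeDesc (Quot.mk _ ⟨i₀, Quot.mk _ (pt i₀, y₀)⟩) (fun i x => Quot.mk _ ⟨i, Quot.mk _ (x, p.2)⟩)
      (fun i => e i p.2) p.1
  have hG : Continuous G := by
    have hp : IsProperMap (Prod.map (Quot.mk _ : (Σ i, X i) → WedgeFam ι X pt) (id : Y → Y)) :=
      isProperMap_wedge_mk.prodMap isProperMap_id
    refine (hp.isClosedMap.isQuotientMap hp.continuous
      (Quot.mk_surjective.prodMap Function.surjective_id)).continuous_iff.2 ?_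
    rw [← (Homeomorph.sigmaProdDistrib (X := X) (Y := Y)).symm.comp_continuous_iff',
      continuous_sigma_iff]
    intro i
    have hi : Continuous fun p : X i × Y => (Quot.mk _ p : HalfSmash (X i) Y (pt i)) :=
      continuous_quot_mk
    exact (continuous_wedge_mk (X := fun i => HalfSmash (X i) Y (pt i))
      (pt := fun i => Quot.mk _ (pt i, y₀)) i).comp hi
  let f : HalfSmash (WedgeFam ι X pt) Y (Quot.mk _ ⟨i₀, pt i₀⟩) → WedgeFam ι
      (fun i => HalfSmash (X i) Y (pt i)) (fun i => Quot.mk _ (pt i, y₀)) := Quot.lift G (by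
    rintro ⟨⟨i, x⟩, y⟩ ⟨⟨j, x'⟩, y'⟩ ⟨h, h'⟩
    obtain rfl := e' i x h
    obtain rfl := e' j x' h'
    exact (e i y).trans (e j y').symm)
  let g : WedgeFam ι (fun i => HalfSmash (X i) Y (pt i)) (fun i => Quot.mk _ (pt i, y₀)) →
      HalfSmash (WedgeFam ι X pt) Y (Quot.mk _ ⟨i₀, pt i₀⟩) :=
    wedgeDesc (Quot.mk _ (Quot.mk _ ⟨i₀, pt i₀⟩, y₀))
      (fun i => Quot.lift (fun p => Quot.mk _ (Quot.mk _ ⟨i, p.1⟩, p.2)) (by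
        rintro ⟨x, y⟩ ⟨x', y'⟩ ⟨h, h'⟩
        dsimp only at h h'
        subst h h'
        exact Quot.sound ⟨wedge_base _ _, wedge_base _ _⟩))
      fun i => Quot.sound ⟨wedge_base _ _, rfl⟩
  have hg : Continuous g := continuous_wedgeDesc _ _ _ fun i => continuous_quot_lift _
    (continuous_quot_mk.comp (((continuous_wedge_mk i).comp continuous_fst).prodMk continuous_snd))
  refine PHE.of_homeomorph ⟨⟨f, g, ?_, ?_⟩, continuous_quot_lift _ hG, hg⟩ rfl
  · rintro ⟨⟨i, x⟩, y⟩
    rfl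
  · rintro ⟨i, ⟨x, y⟩⟩
    rfl

end FiniteWedge

/-- If `W` is (pointed homeomorphic to) a wedge of finitely many spheres of dimensions
`1`, `2` and `3`, then the half-smash `W ⋊ Ω S²` is homotopy equivalent to a wedge of
spheres. -/
theorem halfSmash_loopSphere_wedge_of_spheres
    (W : Type) [TopologicalSpace W] (w₀ : W)
    (m : ℕ) (hm : 0 < m) (d : Fin m → ℕ) (hd : ∀ i, d i = 1 ∨ d i = 2 ∨ d i = 3)
    (e : W ≃ₜ WedgeFam (Fin m) (fun i => SphereSp (d i)) (fun i => spherePt (d i)))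
    (he : e w₀ = Quot.mk _ ⟨⟨0, hm⟩, spherePt (d ⟨0, hm⟩)⟩) :
    ∃ (ι : Type) (d' : ι → ℕ),
      Nonempty (ContinuousMap.HomotopyEquiv
        (HalfSmash W (LoopSp (SphereSp 2) (spherePt 2)) w₀)
        (WedgeFam ι (fun i => SphereSp (d' i)) (fun i => spherePt (d' i)))) := by
  obtain ⟨n, rfl⟩ : ∃ n : Fin m → ℕ, d = fun i => n i + 1 :=
    ⟨fun i => d i - 1, funext fun i => by
      rcases hd i with h | h | h <;> simp [h]⟩
  obtain ⟨E⟩ := homotopyEquiv_path_loop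
  refine ⟨Fin m × ℕ, fun p => n p.1 + p.2 + 1, PHE.homotopyEquiv
    (x₀ := Quot.mk _ (w₀, E constPath)) (y₀ := Quot.mk _ ⟨(⟨0, hm⟩, 0), spherePt _⟩) ?_⟩
  have h1 := PHE.halfSmash_left e he (E constPath)
  have h2 := PHE.halfSmash_right
    (Quot.mk _ ⟨⟨0, hm⟩, spherePt _⟩ : WedgeFam (Fin m) (fun i => SphereSp (n i + 1))
      (fun i => spherePt (n i + 1))) E.symm (E constPath) constPath
  have h3 := PHE.halfSmash_wedge (X := fun i => SphereSp (n i + 1))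
    (pt := fun i => spherePt (n i + 1)) (⟨0, hm⟩ : Fin m) constPath
  have h4 := PHE.wedge (⟨0, hm⟩ : Fin m) fun i => pathSmash_phe_wedge (n i)
  have h5 := PHE.wedge_wedge (X := fun i k => SphereSp (n i + k + 1))
    (pt := fun i k => spherePt (n i + k + 1)) (⟨0, hm⟩ : Fin m) 0
  exact h1.trans (h2.trans (h3.trans (h4.trans h5)))
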